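/- arXiv:1904.09045 — 13 statements merged into one kernel-verified Lean document; each statement's English description precedes it below -/
import Mathlib

section
/- Let k ≥ 2 and let P be a positive cone of a left-ordering of the group ℤ^k. Then for every finite subset S ⊆ P there exists a positive cone Q of a left-ordering of ℤ^k with S ⊆ Q such that Q is discrete (i.e., Q has a least element with respect to the order it defines). Equivalently, the set of discrete orderings is dense in LO(ℤ^k). -/
/-- `P` is the positive cone of a left-ordering of the additive group `ℤ^k`. -/
def IsLeftConeAdd {k : ℕ} (P : Set (Fin k → ℤ)) : Prop :=
  (∀ a ∈ P, ∀ b ∈ P, a + b ∈ P) ∧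
  (∀ g : Fin k → ℤ, g ∈ P ∨ -g ∈ P ∨ g = 0) ∧
  (∀ g ∈ P, -g ∉ P) ∧
  (0 : Fin k → ℤ) ∉ P

/-- Gordan's alternative over `ℤ`, by Fourier–Motzkin elimination: a finite subset of an additive
subsemigroup of `ℤ^k` avoiding `0` lies in an open rational half-space. -/
theorem exists_rat_functional_pos {k : ℕ} (P : Set (Fin k → ℤ))
    (hadd : ∀ a ∈ P, ∀ b ∈ P, a + b ∈ P) (h0 : (0 : Fin k → ℤ) ∉ P)
    (S : Finset (Fin k → ℤ)) (hS : ∀ s ∈ S, s ∈ P) :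
    ∃ f : Fin k → ℚ, ∀ s ∈ S, 0 < ∑ i, f i * (s i : ℚ) := by
  classical
  induction k with
  | zero => exact ⟨0, fun s hs => absurd (Subsingleton.elim s 0 ▸ hS s hs) h0⟩
  | succ k ih =>
    have hsmul : ∀ n : ℤ, 0 < n → ∀ a ∈ P, n • a ∈ P := by
      intro n hn a ha
      induction n, hn using Int.leInduction with
      | base => simpa using ha
      | succ n hn h => rw [add_smul, one_smul]; exact hadd _ h _ ha
    obtain ⟨g, hg⟩ := ih {x | (Fin.cons 0 x : Fin (k + 1) → ℤ) ∈ P}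
      (fun a ha b hb => by
        have h := hadd _ ha _ hb
        have e : (Fin.cons 0 a + Fin.cons 0 b : Fin (k + 1) → ℤ) = Fin.cons 0 (a + b) := by
          ext i; refine Fin.cases ?_ (fun j => ?_) i <;> simp
        rwa [e] at h)
      (fun h => h0 (by
        have e : (Fin.cons 0 0 : Fin (k + 1) → ℤ) = 0 := by
          ext i; refine Fin.cases ?_ (fun j => ?_) i <;> simp
        rwa [Set.mem_ofPred_eq, e] at h))
      ((S.filter (fun s => s 0 = 0)).image Fin.tail ∪
        ((S.filter (fun s => 0 < s 0)) ×ˢ (S.filter (fun s => s 0 < 0))).image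
          (fun p => p.1 0 • Fin.tail p.2 + (-p.2 0) • Fin.tail p.1))
      (by
        intro x hx
        simp only [Finset.mem_union, Finset.mem_image, Finset.mem_filter, Finset.mem_product] at hx
        rcases hx with ⟨s, ⟨hs, hs0⟩, rfl⟩ | ⟨⟨a, b⟩, ⟨⟨ha, ha0⟩, hb, hb0⟩, rfl⟩
        · have e : (Fin.cons 0 (Fin.tail s) : Fin (k + 1) → ℤ) = s := by
            rw [← hs0]; exact Fin.cons_self_tail s
          simpa [e] using hS s hs
        · have h := hadd _ (hsmul _ ha0 b (hS b hb)) _ (hsmul (-b 0) (by simpa using hb0) a (hS a ha))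
          have e : (Fin.cons 0 (a 0 • Fin.tail b + (-b 0) • Fin.tail a) : Fin (k + 1) → ℤ)
              = a 0 • b + (-b 0) • a := by
            ext i
            refine Fin.cases ?_ (fun j => ?_) i
            · simp; ring
            · simp [Fin.tail]
          simpa only [Set.mem_ofPred_eq, e] using h)
    set G : (Fin (k + 1) → ℤ) → ℚ := fun s => ∑ i, g i * (s (Fin.succ i) : ℚ) with hG
    obtain ⟨t, ht₁, ht₂⟩ := Order.exists_between_finsets
      (lo := (S.filter (fun s => 0 < s 0)).image (fun a => -G a / (a 0 : ℚ)))
      (hi := (S.filter (fun s => s 0 < 0)).image (fun b => -G b / (b 0 : ℚ)))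
      (by
        simp only [Finset.mem_image, Finset.mem_filter]
        rintro _ ⟨a, ⟨ha, ha0⟩, rfl⟩ _ ⟨b, ⟨hb, hb0⟩, rfl⟩
        have h := hg (a 0 • Fin.tail b + (-b 0) • Fin.tail a) (Finset.mem_union_right _
          (Finset.mem_image.2 ⟨(a, b), by simp [ha, ha0, hb, hb0], rfl⟩))
        have e : ∑ i, g i * ((a 0 • Fin.tail b + (-b 0) • Fin.tail a) i : ℚ)
            = a 0 * G b - b 0 * G a := by
          simp only [hG, Finset.mul_sum, ← Finset.sum_sub_distrib]
          refine Finset.sum_congr rfl fun i _ => ?_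
          simp [Fin.tail]; ring
        have h' : (0 : ℚ) < a 0 * G b - b 0 * G a := by
          rwa [← e]
        have ha0' : (0 : ℚ) < a 0 := by exact_mod_cast ha0
        have hb0' : (0 : ℚ) < -b 0 := by exact_mod_cast neg_pos.2 hb0
        rw [← neg_div_neg_eq (-G b), div_lt_div_iff₀ ha0' hb0']
        linarith)
    refine ⟨Fin.cons t g, fun s hs => ?_⟩
    rw [Fin.sum_univ_succ]
    simp only [Fin.cons_zero, Fin.cons_succ]
    change 0 < t * (s 0 : ℚ) + G s
    rcases lt_trichotomy (s 0) 0 with h | h | h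
    · have h₁ := ht₂ _ (Finset.mem_image_of_mem _ (Finset.mem_filter.2 ⟨hs, h⟩))
      have h₂ : (s 0 : ℚ) < 0 := by exact_mod_cast h
      rw [lt_div_iff_of_neg h₂] at h₁
      linarith
    · have h₁ := hg (Fin.tail s) (Finset.mem_union_left _
        (Finset.mem_image_of_mem _ (Finset.mem_filter.2 ⟨hs, h⟩)))
      rw [h, Int.cast_zero, mul_zero, zero_add]
      exact h₁
    · have h₁ := ht₁ _ (Finset.mem_image_of_mem _ (Finset.mem_filter.2 ⟨hs, h⟩))
      have h₂ : (0 : ℚ) < s 0 := by exact_mod_cast h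
      rw [div_lt_iff₀ h₂] at h₁
      linarith

/-- Integral version of `exists_rat_functional_pos`. -/
theorem exists_int_functional_pos {k : ℕ} (P : Set (Fin k → ℤ))
    (hadd : ∀ a ∈ P, ∀ b ∈ P, a + b ∈ P) (h0 : (0 : Fin k → ℤ) ∉ P)
    (S : Finset (Fin k → ℤ)) (hS : ∀ s ∈ S, s ∈ P) :
    ∃ f : Fin k → ℤ, ∀ s ∈ S, 0 < ∑ i, f i * s i := by
  obtain ⟨f, hf⟩ := exists_rat_functional_pos P hadd h0 S hS
  have hd : ∀ i, ((f i).den : ℤ) ∣ ∏ j, ((f j).den : ℤ) := fun i =>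
    Finset.dvd_prod_of_mem (fun j => ((f j).den : ℤ)) (Finset.mem_univ i)
  choose c hc using hd
  have hD : (0 : ℚ) < ∏ j, ((f j).den : ℚ) :=
    Finset.prod_pos fun j _ => by exact_mod_cast (f j).den_pos
  refine ⟨fun i => (f i).num * c i, fun s hs => ?_⟩
  have h := mul_pos hD (hf s hs)
  rw [Finset.mul_sum] at h
  have e : ((∑ i, (f i).num * c i * s i : ℤ) : ℚ) =
      ∑ i, (∏ j, ((f j).den : ℚ)) * (f i * (s i : ℚ)) := by
    push_cast
    refine Finset.sum_congr rfl fun i _ => ?_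
    have h₁ : (∏ j, ((f j).den : ℚ)) = (f i).den * c i := by exact_mod_cast hc i
    rw [h₁, ← Rat.den_mul_eq_num (f i)]
    ring
  rw [← e] at h
  exact_mod_cast h

/-- The first nonzero coordinate of `v` exists and is positive. -/
def LexPos {n : ℕ} (v : Fin n → ℤ) : Prop :=
  ∃ i, (∀ j < i, v j = 0) ∧ 0 < v i

theorem LexPos.add {n : ℕ} {v w : Fin n → ℤ} (hv : LexPos v) (hw : LexPos w) :
    LexPos (v + w) := by
  obtain ⟨i, hi, hi'⟩ := hv
  obtain ⟨j, hj, hj'⟩ := hw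
  rcases lt_trichotomy i j with h | rfl | h
  · exact ⟨i, fun l hl => by simp [hi l hl, hj l (hl.trans h)], by simpa [hj i h] using hi'⟩
  · exact ⟨i, fun l hl => by simp [hi l hl, hj l hl], add_pos hi' hj'⟩
  · exact ⟨j, fun l hl => by simp [hj l hl, hi l (hl.trans h)], by simpa [hi j h] using hj'⟩

theorem not_lexPos_zero {n : ℕ} : ¬ LexPos (0 : Fin n → ℤ) := by
  rintro ⟨i, -, hi⟩
  exact lt_irrefl _ hi

theorem lexPos_or_neg {n : ℕ} {v : Fin n → ℤ} (hv : v ≠ 0) : LexPos v ∨ LexPos (-v) := by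
  obtain ⟨i, hi, hmin⟩ := WellFounded.has_min (wellFounded_lt (α := Fin n)) {i | v i ≠ 0}
    (Function.ne_iff.1 hv)
  have hz : ∀ j < i, v j = 0 := fun j hj => by_contra fun h => hmin j h hj
  rcases lt_or_gt_of_ne hi with h | h
  · exact .inr ⟨i, fun j hj => by simp [hz j hj], by simpa using h⟩
  · exact .inl ⟨i, hz, h⟩

theorem isLeftConeAdd_lexPos {k n : ℕ} (φ : (Fin k → ℤ) →+ (Fin n → ℤ))
    (hφ : Function.Injective φ) : IsLeftConeAdd {x | LexPos (φ x)} := by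
  refine ⟨fun a ha b hb => ?_, fun g => ?_, fun g hg hg' => ?_, fun h => ?_⟩
  · simpa only [Set.mem_ofPred_eq, map_add] using LexPos.add ha hb
  · by_cases h : g = 0
    · exact .inr (.inr h)
    · rcases lexPos_or_neg ((map_ne_zero_iff φ hφ).2 h) with h | h
      · exact .inl h
      · exact .inr (.inl (by simpa only [Set.mem_ofPred_eq, map_neg] using h))
  · apply not_lexPos_zero (n := n)
    have h := LexPos.add hg hg'
    rwa [map_neg, add_neg_cancel] at h
  · rw [Set.mem_ofPred_eq, map_zero] at h
    exact not_lexPos_zero h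

/-- The lexicographic order on a nonzero group embedded in `ℤ^n` is discrete: take the leading
index as large as possible, and then the leading coefficient as small as possible. -/
theorem exists_least_lexPos {k n : ℕ} (φ : (Fin k → ℤ) →+ (Fin n → ℤ))
    (hφ : Function.Injective φ) (hne : ∃ x, LexPos (φ x)) :
    ∃ p, LexPos (φ p) ∧ ∀ q, LexPos (φ q) → q = p ∨ LexPos (φ (-p + q)) := by
  let I : Set (Fin n) := {i | ∃ x, (∀ j < i, φ x j = 0) ∧ 0 < φ x i}
  obtain ⟨i, ⟨x, hx⟩, hmax⟩ := WellFounded.has_min (wellFounded_gt (α := Fin n)) I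
    (by obtain ⟨x, i, h⟩ := hne; exact ⟨i, x, h⟩)
  obtain ⟨p, ⟨hp, hp'⟩, hmin⟩ := WellFounded.has_min
    (InvImage.wf (fun x => (φ x i).toNat) wellFounded_lt)
    {x | (∀ j < i, φ x j = 0) ∧ 0 < φ x i} ⟨x, hx⟩
  refine ⟨p, ⟨i, hp, hp'⟩, fun q hq => ?_⟩
  refine or_iff_not_imp_left.2 fun hqp => ?_
  have hne' : φ (-p + q) ≠ 0 := (map_ne_zero_iff φ hφ).2 fun h => hqp (neg_add_eq_zero.1 h).symm
  refine (lexPos_or_neg hne').resolve_right fun ⟨j, hj, hj'⟩ => ?_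
  obtain ⟨l, hl, hl'⟩ := hq
  have hli : l ≤ i := not_lt.1 (hmax l ⟨q, hl, hl'⟩)
  have hji : j ≤ i := not_lt.1 (hmax j ⟨-(-p + q), by simpa using hj, by simpa using hj'⟩)
  simp only [map_add, map_neg, Pi.neg_apply, Pi.add_apply] at hj hj'
  rcases hli.lt_or_eq with h | rfl
  · rcases lt_trichotomy j l with h' | rfl | h'
    · rw [hp j (h'.trans h), hl j h'] at hj'; simp at hj'
    · rw [hp j h] at hj'; omega
    · have := hj l h'; rw [hp l h] at this; omega
  · rcases hji.lt_or_eq with h' | rfl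
    · rw [hp j h', hl j h'] at hj'; simp at hj'
    · refine hmin q ⟨hl, hl'⟩ ?_
      change (φ q j).toNat < (φ p j).toNat
      omega

/-- The set of discrete orderings is dense in `LO(ℤ^k)` for `k ≥ 2`: every finite subset
of a positive cone of `ℤ^k` is contained in a positive cone having a least element. -/
theorem discrete_dense_in_LO_Zk {k : ℕ} (hk : 2 ≤ k)
    (P : Set (Fin k → ℤ)) (hP : IsLeftConeAdd P)
    (S : Finset (Fin k → ℤ)) (hS : ↑S ⊆ P) :
    ∃ Q : Set (Fin k → ℤ), IsLeftConeAdd Q ∧ ↑S ⊆ Q ∧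
      ∃ p ∈ Q, ∀ q ∈ Q, q = p ∨ -p + q ∈ Q := by
  obtain ⟨f, hf⟩ := exists_int_functional_pos P hP.1 hP.2.2.2 S fun s hs => hS hs
  let φ : (Fin k → ℤ) →+ (Fin (k + 1) → ℤ) :=
    AddMonoidHom.mk' (fun x => Fin.cons (∑ i, f i * x i) x) fun a b => by
      ext i
      refine Fin.cases ?_ (fun j => ?_) i
      · simp [mul_add, Finset.sum_add_distrib]
      · simp
  have hφ : Function.Injective φ := fun a b h => funext fun i => congrFun h i.succ
  have : NeZero k := ⟨by omega⟩
  refine ⟨_, isLeftConeAdd_lexPos φ hφ, fun s hs => ⟨0, by simp, hf s hs⟩,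
    exists_least_lexPos φ hφ ?_⟩
  have h1 : φ 1 ≠ 0 := (map_ne_zero_iff φ hφ).2 one_ne_zero
  rcases lexPos_or_neg h1 with h | h
  · exact ⟨1, h⟩
  · exact ⟨-1, by rwa [map_neg]⟩
end

section
/- Let G be a group containing no subgroup isomorphic to the Klein bottle group K = ⟨x, y | xyx⁻¹ = y⁻¹⟩. Let P be the positive cone of a discrete Conradian left-ordering of G with least element h, suppose the cyclic subgroup H = ⟨h⟩ is infinite, normal, and a proper subgroup of G, and suppose the quotient G/H is abelian. Then for every finite subset S ⊆ P there exists a positive cone Q of a dense left-ordering of G with S ⊆ Q. (In particular, P is an accumulation point of dense orderings in LO(G).) -/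
/-- `P` is the positive cone of a left-ordering of `G`: closed under multiplication,
and `G` is the disjoint union of `P`, `P⁻¹` and `{1}`. -/
def IsLeftCone {G : Type*} [Group G] (P : Set G) : Prop :=
  (∀ a ∈ P, ∀ b ∈ P, a * b ∈ P) ∧
  (∀ g : G, g ∈ P ∨ g⁻¹ ∈ P ∨ g = 1) ∧
  (∀ g ∈ P, g⁻¹ ∉ P) ∧
  (1 : G) ∉ P

/-- `P` has a least element with respect to the left-order it defines. -/
def ConeHasLeast {G : Type*} [Group G] (P : Set G) : Prop :=
  ∃ p ∈ P, ∀ q ∈ P, q = p ∨ p⁻¹ * q ∈ P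

/-- `P` is the positive cone of a dense left-ordering of `G`. -/
def IsDenseCone {G : Type*} [Group G] (P : Set G) : Prop :=
  IsLeftCone P ∧ ¬ ConeHasLeast P

/-- `P` is a Conradian positive cone. -/
def IsConradianCone {G : Type*} [Group G] (P : Set G) : Prop :=
  ∀ g ∈ P, ∀ h ∈ P, g⁻¹ * h * g ^ 2 ∈ P

/-- The subgroup `C` is convex relative to the positive cone `P`. -/
def IsConvexSubgroup {G : Type*} [Group G] (P : Set G) (C : Subgroup G) : Prop :=
  ∀ g ∈ C, ∀ h ∈ C, ∀ f : G, g⁻¹ * f ∈ P → f⁻¹ * h ∈ P → f ∈ C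

/-- `G` is bi-orderable: it admits a positive cone invariant under conjugation. -/
def IsBiOrderable (G : Type*) [Group G] : Prop :=
  ∃ P : Set G, IsLeftCone P ∧ ∀ g : G, ∀ p ∈ P, g * p * g⁻¹ ∈ P

/-- The single relation `x y x⁻¹ y` of the Klein bottle group `⟨x, y ∣ x y x⁻¹ = y⁻¹⟩`. -/
def kleinRels : Set (FreeGroup Bool) :=
  {FreeGroup.of true * FreeGroup.of false * (FreeGroup.of true)⁻¹ * FreeGroup.of false}

/-- The Klein bottle group `⟨x, y ∣ x y x⁻¹ = y⁻¹⟩`. -/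
abbrev KleinBottleGroup := PresentedGroup kleinRels

namespace Submonoid

theorem IsMulPointed.eq_one_of_pow_eq_one {G : Type*} [Group G] {N : Submonoid G}
    (hN : N.IsMulPointed) (hs : N.IsMulSpanning) {x : G} {n : ℕ} (hn : 0 < n)
    (hx : x ^ n = 1) : x = 1 := by
  have key : ∀ y ∈ N, y ^ n = 1 → y = 1 := by
    intro y hy hyn
    refine hN y hy ?_
    obtain ⟨m, rfl⟩ := Nat.exists_eq_add_of_lt hn
    have : y⁻¹ = y ^ m := by
      rw [inv_eq_iff_mul_eq_one, ← pow_succ']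
      simpa using hyn
    exact this ▸ pow_mem hy m
  rcases hs x with h | h
  · exact key x h hx
  · exact inv_eq_one.1 (key _ h (by simp [hx]))

variable {A : Type*} [CommGroup A]

theorem exists_le_isMulPointed_isMulSpanning
    (htf : ∀ (x : A) (n : ℕ), 0 < n → x ^ n = 1 → x = 1) {N : Submonoid A}
    (hN : N.IsMulPointed) : ∃ M, N ≤ M ∧ M.IsMulPointed ∧ M.IsMulSpanning := by
  obtain ⟨M, hNM, hM⟩ := zorn_le_nonempty₀ {M : Submonoid A | M.IsMulPointed} (by
    intro c hc hchain y hy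
    have hdir : DirectedOn (· ≤ ·) c := hchain.directedOn
    refine ⟨sSup c, ?_, fun z hz => le_sSup hz⟩
    intro x hx hx'
    rw [mem_sSup_of_directedOn ⟨y, hy⟩ hdir] at hx hx'
    obtain ⟨s, hs, hxs⟩ := hx
    obtain ⟨t, ht, hxt⟩ := hx'
    obtain ⟨u, hu, hsu, htu⟩ := hdir s hs t ht
    exact hc hu x (hsu hxs) (htu hxt)) N hN
  refine ⟨M, hNM, hM.prop, ?_⟩
  have key : ∀ x ∉ M, ∃ n : ℕ, 0 < n ∧ (x ^ n)⁻¹ ∈ M := by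
    intro x hx
    by_contra! hcon
    refine hx (hM.le_of_ge (y := M ⊔ powers x) ?_ le_sup_left
      (le_sup_right (a := M) (mem_powers x)))
    intro z hz hz'
    obtain ⟨a, ha, _, ⟨n, rfl⟩, rfl⟩ := mem_sup.1 hz
    obtain ⟨b, hb, _, ⟨m, rfl⟩, h⟩ := mem_sup.1 hz'
    have hab : (x ^ (n + m))⁻¹ = a * b := by
      rw [eq_comm, ← mul_eq_one_iff_eq_inv, pow_add]
      simp only at h
      calc a * b * (x ^ n * x ^ m) = (a * x ^ n) * (b * x ^ m) := by
            simp only [mul_assoc, mul_left_comm]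
        _ = 1 := by rw [h, mul_inv_cancel]
    have h0 : n + m = 0 := by
      by_contra h0
      exact hcon _ (Nat.pos_of_ne_zero h0) (hab ▸ mul_mem ha hb)
    obtain ⟨rfl, rfl⟩ : n = 0 ∧ m = 0 := by omega
    simp only [pow_zero, mul_one] at h ⊢
    exact hM.prop a ha (h ▸ hb)
  intro x
  by_contra! hx
  obtain ⟨n, hn, hn'⟩ := key x hx.1
  obtain ⟨m, hm, hm'⟩ := key x⁻¹ hx.2
  have h1 : x ^ (n * m) = 1 := by
    refine hM.prop _ ?_ ?_
    · rw [mul_comm, pow_mul]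
      simpa using pow_mem hm' n
    · rw [pow_mul, ← inv_pow]
      exact pow_mem hn' m
  exact hx.1 (htf x _ (Nat.mul_pos hn hm) h1 ▸ one_mem M)

end Submonoid

/-- The elements of `A` with a nontrivial power in the cyclic subgroup generated by `b`. -/
def isolatedZPowers {A : Type*} [CommGroup A] (b : A) : Subgroup A where
  carrier := {x | ∃ n : ℕ, 0 < n ∧ ∃ m : ℤ, x ^ n = b ^ m}
  one_mem' := ⟨1, one_pos, 0, by simp⟩
  mul_mem' := by
    rintro x y ⟨n, hn, m, h⟩ ⟨n', hn', m', h'⟩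
    refine ⟨n * n', Nat.mul_pos hn hn', m * n' + m' * n, ?_⟩
    rw [mul_pow, pow_mul, h, mul_comm n n', pow_mul, h', zpow_add, zpow_mul, zpow_mul,
      zpow_natCast, zpow_natCast]
  inv_mem' := by
    rintro x ⟨n, hn, m, h⟩
    exact ⟨n, hn, -m, by rw [inv_pow, h, zpow_neg]⟩

theorem mem_isolatedZPowers {A : Type*} [CommGroup A] {b x : A} :
    x ∈ isolatedZPowers b ↔ ∃ n : ℕ, 0 < n ∧ ∃ m : ℤ, x ^ n = b ^ m := Iff.rfl

/-- The elements of `A` with a nontrivial power in the submonoid `N`. -/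
def isolatedClosure {A : Type*} [CommGroup A] (N : Submonoid A) : Submonoid A where
  carrier := {x | ∃ n : ℕ, 0 < n ∧ x ^ n ∈ N}
  one_mem' := ⟨1, one_pos, by simp [N.one_mem]⟩
  mul_mem' := by
    rintro x y ⟨n, hn, h⟩ ⟨n', hn', h'⟩
    refine ⟨n * n', Nat.mul_pos hn hn', ?_⟩
    rw [mul_pow, pow_mul, mul_comm n n', pow_mul y]
    exact mul_mem (pow_mem h _) (pow_mem h' _)

theorem mem_isolatedClosure_of_pow_mem {A : Type*} [CommGroup A] {N : Submonoid A} {x : A}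
    {n : ℕ} (hn : 0 < n) (hx : x ^ n ∈ isolatedClosure N) : x ∈ isolatedClosure N := by
  obtain ⟨m, hm, h⟩ := hx
  exact ⟨n * m, Nat.mul_pos hn hm, by rwa [pow_mul]⟩

theorem le_isolatedClosure {A : Type*} [CommGroup A] (N : Submonoid A) :
    N ≤ isolatedClosure N := fun x hx => ⟨1, one_pos, by simpa using hx⟩

/-- Among finitely many positive elements of a torsion-free abelian group, one spans an
extremal ray of the cone they generate. -/
theorem exists_extremal_ray {A : Type*} [CommGroup A]
    (htf : ∀ (x : A) (n : ℕ), 0 < n → x ^ n = 1 → x = 1) {N : Submonoid A}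
    (hN : N.IsMulPointed) (S : Finset A) (hne : S.Nonempty) (hS : ∀ s ∈ S, s ∈ N ∧ s ≠ 1) :
    ∃ b ∈ S, ∀ x ∈ Submonoid.closure {s | s ∈ S ∧ s ∉ isolatedZPowers b},
      x ∈ isolatedZPowers b → x = 1 := by
  classical
  let K : Finset A → Submonoid A := fun M => isolatedClosure (Submonoid.closure (M : Set A))
  obtain ⟨M, hM, hmin⟩ := (S.powerset.filter fun M => ∀ s ∈ S, s ∈ K M).exists_min_image
    Finset.card ⟨S, by
      simp only [Finset.mem_filter, Finset.mem_powerset, subset_refl, true_and]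
      exact fun s hs => le_isolatedClosure _ (Submonoid.subset_closure hs)⟩
  simp only [Finset.mem_filter, Finset.mem_powerset] at hM hmin
  obtain ⟨hMS, hSM⟩ := hM
  have hMN : Submonoid.closure (M : Set A) ≤ N :=
    Submonoid.closure_le.2 fun s hs => (hS s (hMS hs)).1
  have hMne : M.Nonempty := by
    rw [Finset.nonempty_iff_ne_empty]
    rintro rfl
    obtain ⟨s, hs⟩ := hne
    obtain ⟨n, hn, h⟩ := hSM s hs
    exact (hS s hs).2 (htf s n hn (by simpa using h))
  obtain ⟨b, hb⟩ := hMne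
  have hbK : b ∉ K (M.erase b) := by
    intro hbK
    have hle : K M ≤ K (M.erase b) := by
      rintro x ⟨n, hn, hx⟩
      refine mem_isolatedClosure_of_pow_mem hn ((Submonoid.closure_le (S := K (M.erase b))).2
        ?_ hx)
      intro y hy
      by_cases hyb : y = b
      · exact hyb ▸ hbK
      · exact le_isolatedClosure _ (Submonoid.subset_closure (by simpa [hyb] using hy))
    have := hmin (M.erase b) ⟨(Finset.erase_subset _ _).trans hMS, fun s hs => hle (hSM s hs)⟩
    have := Finset.card_erase_lt_of_mem hb
    omega
  have hb1 : b ≠ 1 := (hS b (hMS hb)).2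
  have hbN : b ∈ N := (hS b (hMS hb)).1
  have hM'N : Submonoid.closure ((M.erase b : Finset A) : Set A) ≤ N :=
    (Submonoid.closure_mono (by exact_mod_cast Finset.erase_subset b M)).trans hMN
  -- Every element of `K M` has a power which splits off a power of `b`.
  have hsplit : ∀ x ∈ K M, ∃ n : ℕ, 0 < n ∧ ∃ α : ℕ,
      ∃ u ∈ Submonoid.closure ((M.erase b : Finset A) : Set A), x ^ n = b ^ α * u := by
    rintro x ⟨n, hn, hx⟩
    rw [← Finset.insert_erase hb, Finset.coe_insert, Set.insert_eq, Submonoid.closure_union,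
      Submonoid.mem_sup] at hx
    obtain ⟨y, hy, u, hu, h⟩ := hx
    obtain ⟨α, rfl⟩ := Submonoid.mem_closure_singleton.1 hy
    exact ⟨n, hn, α, u, hu, h.symm⟩
  refine ⟨b, hMS hb, fun x hx hxb => ?_⟩
  have hclS : ∀ y ∈ Submonoid.closure {s | s ∈ S ∧ s ∉ isolatedZPowers b}, y ∈ K M ∧ y ∈ N :=
    fun y hy => ⟨(Submonoid.closure_le (S := K M)).2 (fun s hs => hSM s hs.1) hy,
      (Submonoid.closure_le (S := N)).2 (fun s hs => (hS s hs.1).1) hy⟩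
  induction hx using Submonoid.closure_induction_left with
  | one => rfl
  | mul_left s hs y hy _ =>
    exfalso
    apply hs.2
    obtain ⟨p, hp, α, u, hu, hsu⟩ := hsplit s (hSM s hs.1)
    obtain ⟨q, hq, β, v, hv, hyv⟩ := hsplit y (hclS y hy).1
    obtain ⟨n, hn, m, hxm⟩ := hxb
    have hprod : ((s * y) ^ n) ^ (p * q) =
        b ^ (n * q * α + n * p * β) * (u ^ (n * q) * v ^ (n * p)) := by
      calc ((s * y) ^ n) ^ (p * q) = (s ^ p) ^ (n * q) * (y ^ q) ^ (n * p) := by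
            rw [← pow_mul, mul_pow, ← pow_mul, ← pow_mul]
            congr 2 <;> ring
        _ = _ := by
            rw [hsu, hyv, mul_pow, mul_pow, ← pow_mul, ← pow_mul, pow_add, mul_comm α,
              mul_comm β]
            simp only [mul_assoc, mul_left_comm]
    set w := u ^ (n * q) * v ^ (n * p) with hw
    have hwM : w ∈ Submonoid.closure ((M.erase b : Finset A) : Set A) :=
      mul_mem (pow_mem hu _) (pow_mem hv _)
    have hbw : b ^ (m * (p * q : ℕ) - (n * q * α + n * p * β : ℕ)) = w := by
      rw [zpow_sub, zpow_mul, zpow_natCast, zpow_natCast, ← hxm, hprod]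
      simp
    rcases lt_or_ge 0 (m * (p * q : ℕ) - (n * q * α + n * p * β : ℕ)) with hpos | hneg
    · lift (m * (p * q : ℕ) - (n * q * α + n * p * β : ℕ)) to ℕ using hpos.le with k hk
      refine absurd ⟨k, by omega, ?_⟩ hbK
      rw [← zpow_natCast, hbw]
      exact hwM
    · have hw1 : w = 1 := by
        refine hN w (hM'N hwM) ?_
        rw [← hbw, ← zpow_neg]
        obtain ⟨k, hk⟩ := Int.eq_ofNat_of_zero_le (neg_nonneg.2 hneg)
        rw [hk, zpow_natCast]
        exact pow_mem hbN k
      have hu1 : u ^ (n * q) = 1 := by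
        refine hN _ (hM'N (pow_mem hu _)) ?_
        rw [inv_eq_of_mul_eq_one_right (hw ▸ hw1)]
        exact hM'N (pow_mem hv _)
      have : u = 1 := htf u _ (Nat.mul_pos hn hq) hu1
      exact ⟨p, hp, α, by rw [hsu, this, mul_one, zpow_natCast]⟩

theorem isDenseCone_lex {G D : Type*} [Group G] [Group D] (π : G →* D) {M : Submonoid D}
    (hM : M.IsMulPointed) (hM' : M.IsMulSpanning) {T : Set G} (hker : ∀ g ∈ T, π g = 1)
    (hmul : ∀ a ∈ T, ∀ b ∈ T, a * b ∈ T) (htot : ∀ g, π g = 1 → g ∈ T ∨ g⁻¹ ∈ T ∨ g = 1)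
    (hone : (1 : G) ∉ T) (hne : T.Nonempty) (hdense : ∀ p ∈ T, ∃ q ∈ T, q⁻¹ * p ∈ T) :
    IsDenseCone ({g | π g ∈ M ∧ π g ≠ 1} ∪ T) := by
  have hinv : ∀ g ∈ T, g⁻¹ ∉ T := fun g hg hg' => hone (by simpa using hmul g hg _ hg')
  have hQinv : ∀ g ∈ ({g | π g ∈ M ∧ π g ≠ 1} ∪ T : Set G),
      g⁻¹ ∉ ({g | π g ∈ M ∧ π g ≠ 1} ∪ T : Set G) := by
    rintro g (⟨h1, h2⟩ | hg) (⟨h3, h4⟩ | hg')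
    · exact h2 (hM _ h1 (by simpa using h3))
    · exact h2 (by simpa using hker _ hg')
    · exact h4 (by simp [hker _ hg])
    · exact hinv g hg hg'
  refine ⟨⟨?_, ?_, hQinv, ?_⟩, ?_⟩
  · rintro a (⟨ha, ha'⟩ | ha) b (⟨hb, hb'⟩ | hb)
    · refine Or.inl ⟨by simpa using mul_mem ha hb, fun h => ha' (hM _ ha ?_)⟩
      rw [inv_eq_of_mul_eq_one_right (by simpa using h)]
      exact hb
    · exact Or.inl (by simpa [hker b hb] using ⟨ha, ha'⟩)
    · exact Or.inl (by simpa [hker a ha] using ⟨hb, hb'⟩)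
    · exact Or.inr (hmul a ha b hb)
  · intro g
    by_cases hg : π g = 1
    · rcases htot g hg with h | h | h
      · exact Or.inl (Or.inr h)
      · exact Or.inr (Or.inl (Or.inr h))
      · exact Or.inr (Or.inr h)
    · rcases hM' (π g) with h | h
      · exact Or.inl (Or.inl ⟨h, hg⟩)
      · exact Or.inr (Or.inl (Or.inl (by simpa using ⟨h, hg⟩)))
  · rintro (⟨-, h⟩ | h)
    · exact h (map_one π)
    · exact hone h
  · rintro ⟨p, hp, hleast⟩
    obtain ⟨q, hqT, hq⟩ : ∃ q ∈ T, q⁻¹ * p ∈ ({g | π g ∈ M ∧ π g ≠ 1} ∪ T : Set G) := by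
      rcases hp with hp | hp
      · obtain ⟨t, ht⟩ := hne
        exact ⟨t, ht, Or.inl (by simpa [hker t ht] using hp)⟩
      · obtain ⟨q, hq, h⟩ := hdense p hp
        exact ⟨q, hq, Or.inr h⟩
    rcases hleast q (Or.inr hqT) with rfl | h
    · rcases hq with ⟨-, h⟩ | h
      · simp at h
      · simp [hone] at h
    · exact hQinv _ hq (by simpa using h)

theorem Commute.of_pow_of_central_commutator {G : Type*} [Group G] {a b z : G}
    (hza : Commute z a) (hzb : Commute z b) (hz : ∀ n : ℕ, 0 < n → z ^ n = 1 → z = 1)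
    (hab : a * b = z * (b * a)) {n m : ℕ} (hn : 0 < n) (hm : 0 < m)
    (h : Commute (a ^ n) (b ^ m)) : Commute a b := by
  have h1 : ∀ n : ℕ, a ^ n * b = z ^ n * (b * a ^ n) := by
    intro n
    induction n with
    | zero => simp
    | succ n ih =>
      calc a ^ (n + 1) * b = a * (a ^ n * b) := by rw [pow_succ']; group
        _ = (a * z ^ n) * b * a ^ n := by rw [ih]; group
        _ = z ^ n * (a * b) * a ^ n := by rw [← (hza.pow_left n).eq]; group
        _ = _ := by rw [hab, pow_succ, pow_succ']; group
  have h2 : ∀ m : ℕ, a ^ n * b ^ m = (z ^ n) ^ m * (b ^ m * a ^ n) := by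
    intro m
    induction m with
    | zero => simp
    | succ m ih =>
      calc a ^ n * b ^ (m + 1) = (a ^ n * b ^ m) * b := by rw [pow_succ]; group
        _ = (z ^ n) ^ m * (b ^ m * (a ^ n * b)) := by rw [ih]; group
        _ = (z ^ n) ^ m * ((b ^ m * z ^ n) * (b * a ^ n)) := by rw [h1]; group
        _ = (z ^ n) ^ m * ((z ^ n * b ^ m) * (b * a ^ n)) := by
            rw [((hzb.pow_left n).pow_right m).eq]
        _ = _ := by rw [pow_succ, pow_succ]; group
  have h3 : z = 1 := by
    refine hz (n * m) (Nat.mul_pos hn hm) ?_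
    have := h2 m
    rw [h.eq, eq_comm, mul_eq_right] at this
    rw [pow_mul, this]
  rw [commute_iff_eq, hab, h3, one_mul]

/-- The elements with a positive power `h ^ k * b ^ m` of positive value `k + m * θ`. -/
def slopeCone {G : Type*} [Group G] (h b : G) (θ : ℝ) : Set G :=
  {c | ∃ n : ℕ, 0 < n ∧ ∃ k m : ℤ, c ^ n = h ^ k * b ^ m ∧ 0 < k + m * θ}

section slopeCone

variable {G : Type*} [Group G] {h b : G} {θ : ℝ}

theorem one_notMem_slopeCone (hhb : ∀ k m : ℤ, h ^ k * b ^ m = 1 → k = 0 ∧ m = 0) :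
    (1 : G) ∉ slopeCone h b θ := by
  rintro ⟨n, -, k, m, h1, h2⟩
  obtain ⟨rfl, rfl⟩ := hhb k m (by rw [← h1, one_pow])
  simp at h2

theorem mul_mem_slopeCone (hc : Commute h b) {x y : G} (hxy : ∀ n m : ℕ, 0 < n → 0 < m →
    Commute (x ^ n) (y ^ m) → Commute x y) (hx : x ∈ slopeCone h b θ)
    (hy : y ∈ slopeCone h b θ) : x * y ∈ slopeCone h b θ := by
  obtain ⟨n, hn, k, m, h1, h2⟩ := hx
  obtain ⟨n', hn', k', m', h1', h2'⟩ := hy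
  have hcz : ∀ i j : ℤ, Commute (h ^ i) (b ^ j) := fun i j => (hc.zpow_left i).zpow_right j
  have hcomm : Commute x y := by
    refine hxy n n' hn hn' ?_
    rw [h1, h1']
    exact (((Commute.refl h).zpow_zpow k k').mul_right (hcz k m')).mul_left
      ((hcz k' m).symm.mul_right ((Commute.refl b).zpow_zpow m m'))
  refine ⟨n * n', Nat.mul_pos hn hn', k * n' + k' * n, m * n' + m' * n, ?_, ?_⟩
  · rw [hcomm.mul_pow, pow_mul, h1, mul_comm n n', pow_mul, h1', (hcz k m).mul_pow,
      (hcz k' m').mul_pow, zpow_add, zpow_add, zpow_mul, zpow_mul, zpow_mul, zpow_mul]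
    simp only [zpow_natCast]
    have : Commute ((b ^ m) ^ n') ((h ^ k') ^ n) := ((hcz k' m).symm.pow_left _).pow_right _
    rw [mul_assoc, ← mul_assoc ((b ^ m) ^ n'), this.eq]
    simp only [mul_assoc]
  · push_cast
    have : (0 : ℝ) < n := by exact_mod_cast hn
    have : (0 : ℝ) < n' := by exact_mod_cast hn'
    have : 0 < (k + m * θ) * n' + (k' + m' * θ) * n := by positivity
    linarith

theorem mem_or_inv_mem_slopeCone (hc : Commute h b) (hθ : Irrational θ) {c : G}
    (htf : ∀ n : ℕ, 0 < n → c ^ n = 1 → c = 1)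
    (hcb : ∃ n : ℕ, 0 < n ∧ ∃ k m : ℤ, c ^ n = h ^ k * b ^ m) :
    c ∈ slopeCone h b θ ∨ c⁻¹ ∈ slopeCone h b θ ∨ c = 1 := by
  obtain ⟨n, hn, k, m, h1⟩ := hcb
  rcases lt_trichotomy 0 (k + m * θ) with hpos | hzero | hneg
  · exact Or.inl ⟨n, hn, k, m, h1, hpos⟩
  · have hm : m = 0 := by
      by_contra hm
      refine (hθ.intCast_mul hm).intCast_add k ⟨0, ?_⟩
      simpa using hzero
    subst hm
    have hk : k = 0 := by simpa using hzero.symm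
    subst hk
    exact Or.inr (Or.inr (htf n hn (by simpa using h1)))
  · refine Or.inr (Or.inl ⟨n, hn, -k, -m, ?_, ?_⟩)
    · rw [inv_pow, h1, mul_inv_rev, zpow_neg, zpow_neg]
      exact ((hc.zpow_left k).zpow_right m).inv_inv.symm
    · push_cast
      linarith

theorem exists_mem_slopeCone_inv_mul_mem (hc : Commute h b) (hθ : Irrational θ) {p : G}
    (hph : Commute h p) (hpb : ∀ n m : ℕ, 0 < n → 0 < m → Commute (p ^ n) (b ^ m) → Commute p b)
    (hp : p ∈ slopeCone h b θ) :
    ∃ q ∈ slopeCone h b θ, q⁻¹ * p ∈ slopeCone h b θ := by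
  obtain ⟨n, hn, k, m, h1, h2⟩ := hp
  have hn' : (0 : ℝ) < n := by exact_mod_cast hn
  have hdense : Dense (AddSubgroup.closure {θ, 1} : Set ℝ) :=
    dense_addSubgroupClosure_pair_iff.2 (by simpa using hθ)
  obtain ⟨x, hx, hx0, hx1⟩ := hdense.exists_between (div_pos h2 hn')
  obtain ⟨m', k', rfl⟩ := AddSubgroup.mem_closure_pair.1 hx
  simp only [zsmul_eq_mul, mul_one] at hx0 hx1
  have hcz : ∀ i j : ℤ, Commute (h ^ i) (b ^ j) := fun i j => (hc.zpow_left i).zpow_right j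
  have hpb' : Commute p b := by
    refine hpb n 1 hn one_pos ?_
    rw [h1, pow_one]
    exact (hc.zpow_left k).mul_left ((Commute.refl b).zpow_left m)
  refine ⟨h ^ k' * b ^ m', ⟨1, one_pos, k', m', by simp, by linarith⟩,
    n, hn, k - k' * n, m - m' * n, ?_, ?_⟩
  · have : Commute (h ^ k' * b ^ m')⁻¹ p :=
      ((hph.zpow_left k').mul_left (hpb'.symm.zpow_left m')).inv_left
    rw [this.mul_pow, h1, inv_pow, (hcz k' m').mul_pow, zpow_sub, zpow_sub, zpow_mul, zpow_mul,
      zpow_natCast, zpow_natCast, inv_mul_eq_iff_eq_mul]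
    have e1 : Commute (h ^ k) ((h ^ k') ^ n) := ((Commute.refl h).zpow_zpow k k').pow_right n
    have e2 : Commute (b ^ m) ((b ^ m') ^ n) := ((Commute.refl b).zpow_zpow m m').pow_right n
    have e3 : Commute ((b ^ m') ^ n) (h ^ k * ((h ^ k') ^ n)⁻¹) :=
      ((hcz k m').symm.pow_left n).mul_right (((hcz k' m').symm.pow_left n).pow_right n).inv_right
    calc h ^ k * b ^ m = (h ^ k') ^ n * (h ^ k * ((h ^ k') ^ n)⁻¹) *
          ((b ^ m') ^ n * (b ^ m * ((b ^ m') ^ n)⁻¹)) := by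
          rw [← mul_assoc _ (h ^ k), ← e1.eq, ← mul_assoc _ (b ^ m), ← e2.eq]
          simp
      _ = _ := by
          simp only [mul_assoc]
          rw [← mul_assoc ((b ^ m') ^ n) (h ^ k), ← mul_assoc ((b ^ m') ^ n * h ^ k),
            mul_assoc ((b ^ m') ^ n) (h ^ k), e3.eq]
          simp only [mul_assoc]
  · push_cast
    rw [lt_div_iff₀ hn'] at hx1
    linarith

end slopeCone

namespace KleinBottleGroup

theorem exists_eq_zpow_mul_zpow (z : KleinBottleGroup) : ∃ i j : ℤ,
    z = PresentedGroup.of false ^ i * PresentedGroup.of true ^ j := by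
  set y : KleinBottleGroup := PresentedGroup.of false
  set x : KleinBottleGroup := PresentedGroup.of true
  have hrel : x * y * x⁻¹ = y⁻¹ := by
    rw [← mul_eq_one_iff_eq_inv]
    exact PresentedGroup.one_of_mem (rels := kleinRels) rfl
  have hx : ∀ i : ℤ, x * y ^ i = y ^ (-i) * x := by
    intro i
    rw [← mul_inv_eq_iff_eq_mul, ← conj_zpow, hrel, inv_zpow, zpow_neg]
  have hx' : ∀ i : ℤ, x⁻¹ * y ^ i = y ^ (-i) * x⁻¹ := by
    intro i
    rw [inv_mul_eq_iff_eq_mul, ← mul_assoc, hx, neg_neg, mul_inv_cancel_right]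
  have hmem : z ∈ Subgroup.closure (Set.range (PresentedGroup.of (rels := kleinRels))) := by
    rw [PresentedGroup.closure_range_of]
    trivial
  induction hmem using Subgroup.closure_induction_left with
  | one => exact ⟨0, 0, by simp⟩
  | mul_left s hs z _ ih =>
    obtain ⟨i, j, rfl⟩ := ih
    obtain ⟨_ | _, rfl⟩ := hs
    · exact ⟨1 + i, j, by rw [zpow_add, zpow_one, mul_assoc]⟩
    · exact ⟨-i, 1 + j, by
        rw [← mul_assoc, zpow_add x, zpow_one, ← mul_assoc]
        exact congrArg (· * x ^ j) (hx i)⟩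
  | inv_mul_cancel s hs z _ ih =>
    obtain ⟨i, j, rfl⟩ := ih
    obtain ⟨_ | _, rfl⟩ := hs
    · exact ⟨-1 + i, j, by rw [zpow_add, zpow_neg_one, mul_assoc]⟩
    · exact ⟨-i, -1 + j, by
        rw [← mul_assoc, zpow_add x, zpow_neg_one, ← mul_assoc]
        exact congrArg (· * x ^ j) (hx' i)⟩

theorem exists_subgroup_mulEquiv {G : Type*} [Group G] {g h : G} (hgh : g * h * g⁻¹ = h⁻¹)
    (hind : ∀ i j : ℤ, h ^ i * g ^ j = 1 → i = 0 ∧ j = 0) :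
    ∃ H : Subgroup G, Nonempty (H ≃* KleinBottleGroup) := by
  let f : Bool → G := fun b => if b then g else h
  have hf : ∀ r ∈ kleinRels, FreeGroup.lift f r = 1 := by
    rintro r rfl
    simp [f, hgh]
  have hinj : Function.Injective (PresentedGroup.toGroup hf) := by
    rw [injective_iff_map_eq_one]
    intro z hz
    obtain ⟨i, j, rfl⟩ := exists_eq_zpow_mul_zpow z
    rw [map_mul, map_zpow, map_zpow, PresentedGroup.toGroup.of, PresentedGroup.toGroup.of] at hz
    obtain ⟨rfl, rfl⟩ := hind i j (by simpa [f] using hz)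
    simp
  exact ⟨_, ⟨(MonoidHom.ofInjective hinj).symm⟩⟩

end KleinBottleGroup

theorem central_of_no_kleinBottleGroup {G : Type*} [Group G]
    (hK : ¬ ∃ H : Subgroup G, Nonempty (H ≃* KleinBottleGroup))
    (htf : ∀ (x : G) (n : ℕ), 0 < n → x ^ n = 1 → x = 1) {h : G}
    (hinf : ∀ n : ℤ, h ^ n = 1 → n = 0) (hnormal : (Subgroup.zpowers h).Normal) (g : G) :
    Commute h g := by
  obtain ⟨k, hk⟩ := hnormal.conj_mem h (Subgroup.mem_zpowers h) g
  obtain ⟨l, hl⟩ := hnormal.conj_mem h (Subgroup.mem_zpowers h) g⁻¹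
  simp only [inv_inv] at hk hl
  have hkl : k * l = 1 := by
    have h1 : h ^ (k * l) = h := by
      rw [zpow_mul, hk, conj_zpow, hl]
      group
    have := hinf (k * l - 1) (by rw [zpow_sub, h1]; simp)
    omega
  rcases Int.eq_one_or_neg_one_of_mul_eq_one hkl with rfl | rfl
  · rw [zpow_one, eq_mul_inv_iff_mul_eq] at hk
    exact hk
  · rw [zpow_neg_one] at hk
    refine absurd (KleinBottleGroup.exists_subgroup_mulEquiv hk.symm fun i j hij => ?_) hK
    have hgj : g ^ j = h ^ (-i) := by rw [zpow_neg, eq_inv_of_mul_eq_one_right hij]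
    have hi : i = 0 := by
      have h1 : g * h ^ (-i) * g⁻¹ = h ^ (-i) := by
        rw [← hgj, ← zpow_one_add, add_comm, zpow_add_one, mul_inv_cancel_right]
      rw [← conj_zpow, ← hk, zpow_neg, inv_zpow, inv_inv] at h1
      have := hinf (i + i) (by
        rw [zpow_add]
        nth_rewrite 1 [h1]
        simp)
      omega
    refine ⟨hi, ?_⟩
    by_contra hj
    have hg : g = 1 := by
      rw [hi, neg_zero, zpow_zero] at hgj
      refine htf g j.natAbs (Int.natAbs_pos.2 hj) ?_
      rcases Int.natAbs_eq j with e | e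
      · rw [← zpow_natCast, ← e, hgj]
      · rw [← zpow_natCast, ← neg_eq_iff_eq_neg.2 e, zpow_neg, hgj, inv_one]
    rw [hg] at hk
    have := hinf 2 (by
      rw [zpow_two]
      nth_rewrite 1 [show h = h⁻¹ by simpa using hk.symm]
      simp)
    omega

theorem exists_isDenseCone_of_central {G A : Type*} [Group G] [CommGroup A] (φ : G →* A)
    (hφ : Function.Surjective φ) {h : G} (hker : ∀ g, φ g = 1 ↔ g ∈ Subgroup.zpowers h)
    (hc : ∀ g, Commute h g) (hinf : ∀ n : ℤ, h ^ n = 1 → n = 0) {N : Submonoid G}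
    (hN : N.IsMulPointed) (hspan : N.IsMulSpanning) (hNφ : (N.map φ).IsMulPointed)
    (hh : h ∈ N) (S : Finset G) (hS : ∀ s ∈ S, s ∈ N ∧ s ≠ 1) (hne : ∃ s ∈ S, φ s ≠ 1) :
    ∃ Q : Set G, IsDenseCone Q ∧ ↑S ⊆ Q := by
  classical
  have htfG : ∀ (x : G) (n : ℕ), 0 < n → x ^ n = 1 → x = 1 :=
    fun x n hn => hN.eq_one_of_pow_eq_one hspan hn
  have hspanφ : (N.map φ).IsMulSpanning := by
    intro a
    obtain ⟨g, rfl⟩ := hφ a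
    rw [← map_inv]
    exact (hspan g).imp (Submonoid.mem_map_of_mem φ) (Submonoid.mem_map_of_mem φ)
  have htfA : ∀ (x : A) (n : ℕ), 0 < n → x ^ n = 1 → x = 1 :=
    fun x n hn => hNφ.eq_one_of_pow_eq_one hspanφ hn
  have hSφ : ∀ s ∈ (S.image φ).filter (· ≠ 1), s ∈ N.map φ ∧ s ≠ 1 := by
    intro s hs
    obtain ⟨hs, hs1⟩ := Finset.mem_filter.1 hs
    obtain ⟨t, ht, rfl⟩ := Finset.mem_image.1 hs
    exact ⟨Submonoid.mem_map_of_mem φ (hS t ht).1, hs1⟩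
  obtain ⟨_, hb, hext⟩ := exists_extremal_ray htfA hNφ ((S.image φ).filter (· ≠ 1))
    (by
      obtain ⟨s, hs, hs1⟩ := hne
      exact ⟨φ s, Finset.mem_filter.2 ⟨Finset.mem_image_of_mem φ hs, hs1⟩⟩) hSφ
  obtain ⟨hbN, hb1⟩ := hSφ _ hb
  obtain ⟨b, -, rfl⟩ := Finset.mem_image.1 (Finset.mem_filter.1 hb).1
  set R := Submonoid.closure
    {s | s ∈ (S.image φ).filter (· ≠ 1) ∧ s ∉ isolatedZPowers (φ b)} with hR
  have hRN : R ≤ N.map φ := (Submonoid.closure_le (S := N.map φ)).2 fun s hs => (hSφ s hs.1).1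
  -- Order the quotient by the isolated subgroup of `φ b`.
  let ψ : A →* A ⧸ isolatedZPowers (φ b) := QuotientGroup.mk' _
  have hψ : ∀ a, ψ a = 1 ↔ a ∈ isolatedZPowers (φ b) := QuotientGroup.eq_one_iff
  have htfD : ∀ (x : A ⧸ isolatedZPowers (φ b)) (n : ℕ), 0 < n → x ^ n = 1 → x = 1 := by
    intro x n hn hx
    obtain ⟨a, rfl⟩ := QuotientGroup.mk'_surjective _ x
    rw [← map_pow] at hx
    obtain ⟨m, hm, j, hj⟩ := (hψ _).1 hx
    exact (hψ a).2 ⟨n * m, Nat.mul_pos hn hm, j, by rw [pow_mul, hj]⟩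
  have hpointed : (R.map ψ).IsMulPointed := by
    rintro _ ⟨x, hx, rfl⟩ ⟨y, hy, hxy⟩
    have hxy1 : x * y = 1 := by
      refine hext _ (mul_mem hx hy) ((hψ _).1 ?_)
      rw [map_mul, hxy, mul_inv_cancel]
    have hx1 : x = 1 := hNφ x (hRN hx) (by
      rw [inv_eq_of_mul_eq_one_right hxy1]
      exact hRN hy)
    rw [hx1, map_one]
  obtain ⟨M, hRM, hM, hM'⟩ := Submonoid.exists_le_isMulPointed_isMulSpanning htfD hpointed
  have hφh : ∀ k : ℤ, φ (h ^ k) = 1 := fun k => (hker _).2 ⟨k, rfl⟩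
  have hπ : ∀ g, (ψ.comp φ) g = 1 ↔ ∃ n : ℕ, 0 < n ∧ ∃ k m : ℤ, g ^ n = h ^ k * b ^ m := by
    intro g
    rw [MonoidHom.comp_apply, hψ, mem_isolatedZPowers]
    refine exists_congr fun n => and_congr_right fun _ => ⟨?_, ?_⟩
    · rintro ⟨m, hm⟩
      obtain ⟨k, hk⟩ := (hker (g ^ n * (b ^ m)⁻¹)).1 (by simp [hm])
      exact ⟨k, m, by simp only at hk; rw [hk, inv_mul_cancel_right]⟩
    · rintro ⟨k, m, hm⟩
      exact ⟨m, by rw [← map_pow, hm, map_mul, hφh, one_mul, map_zpow]⟩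
  have hbm : ∀ m : ℤ, φ b ^ m = 1 → m = 0 := by
    intro m hm
    by_contra h0
    exact hb1 (htfA _ m.natAbs (Int.natAbs_pos.2 h0) (pow_natAbs_eq_one.2 hm))
  have hhb : ∀ k m : ℤ, h ^ k * b ^ m = 1 → k = 0 ∧ m = 0 := by
    intro k m hkm
    obtain rfl : m = 0 := hbm m (by simpa [hφh k, -map_zpow, ← map_zpow φ b] using congrArg φ hkm)
    exact ⟨hinf k (by simpa using hkm), rfl⟩
  have hcomm : ∀ x y : G, ∀ n m : ℕ, 0 < n → 0 < m → Commute (x ^ n) (y ^ m) → Commute x y := by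
    intro x y n m hn hm hxy
    obtain ⟨k, hk⟩ := (hker (x * y * (y * x)⁻¹)).1 (by
      rw [map_mul, map_inv, map_mul, map_mul, mul_comm (φ y), mul_inv_cancel])
    simp only at hk
    exact Commute.of_pow_of_central_commutator ((hc x).zpow_left k) ((hc y).zpow_left k)
      (htfG (h ^ k)) (by rw [hk, inv_mul_cancel_right]) hn hm hxy
  -- Elements of `S` over the ray of `φ b` are positive for every large slope.
  have hlarge : ∀ s ∈ S, (ψ.comp φ) s = 1 → ∃ B : ℝ, ∀ θ, B < θ → s ∈ slopeCone h b θ := by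
    intro s hs hs1
    obtain ⟨n, hn, k, m, hm⟩ := (hπ s).1 hs1
    rcases lt_trichotomy m 0 with hneg | rfl | hpos
    · exfalso
      have h1 : φ (s ^ n) = 1 := by
        refine hNφ _ (Submonoid.mem_map_of_mem φ (pow_mem (hS s hs).1 n)) ?_
        obtain ⟨j, hj⟩ := Int.eq_ofNat_of_zero_le (neg_nonneg.2 hneg.le)
        rw [hm, map_mul, hφh, one_mul, map_zpow, ← zpow_neg, hj, zpow_natCast]
        exact pow_mem hbN j
      rw [hm, map_mul, hφh, one_mul, map_zpow] at h1
      exact hneg.ne (hbm m h1)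
    · refine ⟨0, fun θ _ => ⟨n, hn, k, 0, hm, ?_⟩⟩
      rw [zpow_zero, mul_one] at hm
      have hsn : s ^ n ≠ 1 := fun e => (hS s hs).2 (htfG s n hn e)
      have : 0 < k := by
        by_contra! hk
        refine hsn (hN _ (pow_mem (hS s hs).1 n) ?_)
        obtain ⟨j, hj⟩ := Int.eq_ofNat_of_zero_le (neg_nonneg.2 hk)
        rw [hm, ← zpow_neg, hj, zpow_natCast]
        exact pow_mem hh j
      simpa using this
    · refine ⟨-k / m, fun θ hθ => ⟨n, hn, k, m, hm, ?_⟩⟩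
      rw [div_lt_iff₀ (by exact_mod_cast hpos)] at hθ
      linarith
  obtain ⟨θ, hθ, hSθ⟩ : ∃ θ : ℝ, Irrational θ ∧
      ∀ s ∈ S, (ψ.comp φ) s = 1 → s ∈ slopeCone h b θ := by
    have : ∀ s : G, ∃ B : ℝ, s ∈ S → (ψ.comp φ) s = 1 → ∀ θ, B < θ → s ∈ slopeCone h b θ := by
      intro s
      by_cases hs : s ∈ S ∧ (ψ.comp φ) s = 1
      · obtain ⟨B, hB⟩ := hlarge s hs.1 hs.2
        exact ⟨B, fun _ _ => hB⟩
      · exact ⟨0, fun h1 h2 => absurd ⟨h1, h2⟩ hs⟩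
    choose B hB using this
    obtain ⟨B', hB'⟩ := (S.image B).bddAbove
    obtain ⟨θ, hθ, hlt, -⟩ := exists_irrational_btwn (lt_add_one B')
    exact ⟨θ, hθ, fun s hs hs1 => hB s hs hs1 θ
      ((hB' (by exact_mod_cast Finset.mem_image_of_mem B hs)).trans_lt hlt)⟩
  refine ⟨_, isDenseCone_lex (ψ.comp φ) hM hM' (T := slopeCone h b θ) ?_ ?_ ?_
    (one_notMem_slopeCone hhb) ⟨h, 1, one_pos, 1, 0, by simp, by simp⟩ ?_, ?_⟩
  · rintro g ⟨n, hn, k, m, hm, -⟩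
    exact (hπ g).2 ⟨n, hn, k, m, hm⟩
  · exact fun x hx y hy => mul_mem_slopeCone (hc b) (hcomm x y) hx hy
  · exact fun g hg => mem_or_inv_mem_slopeCone (hc b) hθ (htfG g) ((hπ g).1 hg)
  · exact fun p hp => exists_mem_slopeCone_inv_mul_mem (hc b) hθ (hc p) (hcomm p b) hp
  · intro s hs
    by_cases hs1 : (ψ.comp φ) s = 1
    · exact Or.inr (hSθ s hs hs1)
    · refine Or.inl ⟨hRM (Submonoid.mem_map_of_mem ψ (Submonoid.subset_closure ⟨?_, ?_⟩)), hs1⟩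
      · refine Finset.mem_filter.2 ⟨Finset.mem_image_of_mem φ hs, fun h1 => hs1 ?_⟩
        rw [MonoidHom.comp_apply, h1, map_one]
      · exact fun h1 => hs1 ((hψ _).2 h1)

/-- The positive cone of a left-ordering together with the identity. -/
def IsLeftCone.toSubmonoid {G : Type*} [Group G] {P : Set G} (hP : IsLeftCone P) :
    Submonoid G where
  carrier := {g | g ∈ P ∨ g = 1}
  one_mem' := Or.inr rfl
  mul_mem' := by
    rintro a b (ha | rfl) (hb | rfl)
    · exact Or.inl (hP.1 a ha b hb)
    · exact Or.inl (by simpa using ha)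
    · exact Or.inl (by simpa using hb)
    · exact Or.inr (by simp)

theorem IsLeftCone.isMulPointed {G : Type*} [Group G] {P : Set G} (hP : IsLeftCone P) :
    hP.toSubmonoid.IsMulPointed := by
  rintro x (hx | hx) (hx' | hx')
  · exact absurd hx' (hP.2.2.1 x hx)
  · exact inv_eq_one.1 hx'
  · exact hx
  · exact hx

theorem IsLeftCone.isMulSpanning {G : Type*} [Group G] {P : Set G} (hP : IsLeftCone P) :
    hP.toSubmonoid.IsMulSpanning := by
  intro x
  rcases hP.2.1 x with h | h | h
  · exact Or.inl (Or.inl h)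
  · exact Or.inr (Or.inl h)
  · exact Or.inl (Or.inr h)

/-- A positive element outside the subgroup generated by the least element stays positive after
multiplication by any power of the least element. -/
theorem IsLeftCone.zpow_mul_mem {G : Type*} [Group G] {P : Set G} (hP : IsLeftCone P) {h : G}
    (hhP : h ∈ P) (hleast : ∀ q ∈ P, q = h ∨ h⁻¹ * q ∈ P) {g : G} (hg : g ∈ P)
    (hgH : g ∉ Subgroup.zpowers h) (k : ℤ) : h ^ k * g ∈ P := by
  have hnotMem : ∀ k : ℤ, h ^ k * g ∉ Subgroup.zpowers h := fun k hk =>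
    hgH ((Subgroup.mul_mem_cancel_left _ (Subgroup.zpow_mem _ (Subgroup.mem_zpowers h) k)).1 hk)
  induction k using Int.induction_on with
  | zero => simpa using hg
  | succ k ih =>
    rw [add_comm, zpow_one_add, mul_assoc]
    exact hP.1 h hhP _ ih
  | pred k ih =>
    rw [sub_eq_add_neg, add_comm, zpow_add, zpow_neg_one, mul_assoc]
    exact (hleast _ ih).resolve_left fun e => hnotMem (-(k : ℤ)) (by
      rw [e]
      exact Subgroup.mem_zpowers h)

/-- If `G` contains no copy of the Klein bottle group, `P` is a discrete Conradian cone
with least element `h` generating an infinite, normal, proper cyclic subgroup with abelian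
quotient, then `P` is approximated by dense orderings. -/
theorem discrete_conradian_accumulation_of_dense {G : Type*} [Group G]
    (hK : ¬ ∃ H : Subgroup G, Nonempty (H ≃* KleinBottleGroup))
    (P : Set G) (hP : IsLeftCone P) (hConr : IsConradianCone P)
    (h : G) (hhP : h ∈ P) (hleast : ∀ q ∈ P, q = h ∨ h⁻¹ * q ∈ P)
    (hinf : ∀ n : ℤ, h ^ n = 1 → n = 0)
    (hnormal : (Subgroup.zpowers h).Normal)
    (hproper : Subgroup.zpowers h ≠ ⊤)
    (hquotab : ∀ a b : G, a * b * a⁻¹ * b⁻¹ ∈ Subgroup.zpowers h)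
    (S : Finset G) (hS : ↑S ⊆ P) :
    ∃ Q : Set G, IsDenseCone Q ∧ ↑S ⊆ Q := by
  have htf : ∀ (x : G) (n : ℕ), 0 < n → x ^ n = 1 → x = 1 :=
    fun x n hn => hP.isMulPointed.eq_one_of_pow_eq_one hP.isMulSpanning hn
  let _ : CommGroup (G ⧸ Subgroup.zpowers h) :=
    { QuotientGroup.Quotient.group (Subgroup.zpowers h) with
      mul_comm := by
        intro x y
        obtain ⟨a, rfl⟩ := QuotientGroup.mk'_surjective _ x
        obtain ⟨b, rfl⟩ := QuotientGroup.mk'_surjective _ y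
        have hab : QuotientGroup.mk' (Subgroup.zpowers h) (a * b * a⁻¹ * b⁻¹) = 1 :=
          (QuotientGroup.eq_one_iff _).2 (hquotab a b)
        rw [map_mul, map_mul, map_inv, map_inv, mul_inv_eq_one, mul_inv_eq_iff_eq_mul,
          map_mul] at hab
        exact hab }
  let φ : G →* G ⧸ Subgroup.zpowers h := QuotientGroup.mk' (Subgroup.zpowers h)
  have hker : ∀ g, φ g = 1 ↔ g ∈ Subgroup.zpowers h := QuotientGroup.eq_one_iff
  have hpointed : (hP.toSubmonoid.map φ).IsMulPointed := by
    rintro _ ⟨x, hx, rfl⟩ ⟨y, hy, hxy⟩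
    rw [hker]
    by_contra hxH
    have hxP : x ∈ P := hx.resolve_right fun e => hxH (e ▸ one_mem _)
    obtain ⟨k, hk⟩ := (hker (x * y)).1 (by rw [map_mul, hxy, mul_inv_cancel])
    have hmem := hP.zpow_mul_mem hhP hleast hxP hxH (-k)
    have hy' : h ^ (-k) * x = y⁻¹ := by
      simp only at hk
      rw [zpow_neg, hk]
      group
    rw [hy'] at hmem
    rcases hy with hy | rfl
    · exact hP.2.2.1 y hy hmem
    · exact hP.2.2.2 (by simpa using hmem)
  classical
  obtain ⟨g, hgP, hgH⟩ : ∃ g ∈ P, g ∉ Subgroup.zpowers h := by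
    obtain ⟨g, hg⟩ : ∃ g, g ∉ Subgroup.zpowers h := by
      by_contra! hall
      exact hproper ((Subgroup.eq_top_iff' _).2 hall)
    rcases hP.2.1 g with h1 | h1 | h1
    · exact ⟨g, h1, hg⟩
    · exact ⟨g⁻¹, h1, fun h2 => hg (inv_mem_iff.1 h2)⟩
    · exact absurd (h1 ▸ one_mem _) hg
  obtain ⟨Q, hQ, hSQ⟩ := exists_isDenseCone_of_central φ (QuotientGroup.mk'_surjective _) hker
    (central_of_no_kleinBottleGroup hK htf hinf hnormal) hinf hP.isMulPointed hP.isMulSpanning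
    hpointed (Or.inl hhP) (insert g S) (by
      intro s hs
      have hsP : s ∈ P := by
        rcases Finset.mem_insert.1 hs with rfl | hs
        · exact hgP
        · exact hS hs
      exact ⟨Or.inl hsP, fun e => hP.2.2.2 (e ▸ hsP)⟩)
    ⟨g, Finset.mem_insert_self _ _, fun e => hgH ((hker g).1 e)⟩
  exact ⟨Q, hQ, fun s hs => hSQ (Finset.mem_insert_of_mem hs)⟩
end

section
/- Let G be a bi-orderable group and let A be an abelian subgroup of G. Then the isolator I_G(A) = {g ∈ G : g^k ∈ A for some nonzero integer k} is an abelian subgroup of G (it is closed under multiplication and inverses, and all of its elements commute). -/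
/-- The isolator of a subset `A` of a group `G`. -/
def isolator {G : Type*} [Group G] (A : Set G) : Set G :=
  {g : G | ∃ k : ℤ, k ≠ 0 ∧ g ^ k ∈ A}

/-- In a bi-ordered group, `x < y` implies `x ^ (n + 1) < y ^ (n + 1)`. -/
theorem IsLeftCone.inv_pow_mul_pow_mem {G : Type*} [Group G] {P : Set G} (hP : IsLeftCone P)
    (hconj : ∀ g : G, ∀ p ∈ P, g * p * g⁻¹ ∈ P) {x y : G} (h : x⁻¹ * y ∈ P) (n : ℕ) :
    (x ^ (n + 1))⁻¹ * y ^ (n + 1) ∈ P := by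
  induction n with
  | zero => simpa using h
  | succ n ih =>
    have key := hP.1 _ (hconj x⁻¹ _ ih) _ h
    have e : (x ^ (n + 1 + 1))⁻¹ * y ^ (n + 1 + 1)
        = x⁻¹ * ((x ^ (n + 1))⁻¹ * y ^ (n + 1)) * x⁻¹⁻¹ * (x⁻¹ * y) := by
      rw [pow_succ x (n + 1), pow_succ y (n + 1)]
      group
    rwa [e]

/-- Roots are unique in a bi-orderable group. -/
theorem IsBiOrderable.zpow_left_injective {G : Type*} [Group G] (hG : IsBiOrderable G)
    {k : ℤ} (hk : k ≠ 0) : Function.Injective fun x : G => x ^ k := by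
  obtain ⟨P, hP, hconj⟩ := hG
  intro x y hxy
  have hpow : ∃ n : ℕ, x ^ (n + 1) = y ^ (n + 1) := by
    obtain ⟨n, hn⟩ := Nat.exists_eq_succ_of_ne_zero (Int.natAbs_ne_zero.mpr hk)
    refine ⟨n, ?_⟩
    rw [← Nat.succ_eq_add_one, ← hn]
    rcases Int.natAbs_eq k with e | e
    · simp only at hxy
      rw [e, zpow_natCast, zpow_natCast] at hxy
      exact hxy
    · simp only at hxy
      rw [e, zpow_neg, zpow_neg, zpow_natCast, zpow_natCast] at hxy
      exact inv_injective hxy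
  obtain ⟨n, hn⟩ := hpow
  rcases hP.2.1 (x⁻¹ * y) with h | h | h
  · have := hP.inv_pow_mul_pow_mem hconj h n
    rw [hn, inv_mul_cancel] at this
    exact absurd this hP.2.2.2
  · rw [mul_inv_rev, inv_inv] at h
    have := hP.inv_pow_mul_pow_mem hconj h n
    rw [hn, inv_mul_cancel] at this
    exact absurd this hP.2.2.2
  · exact inv_mul_eq_one.mp h

/-- In a bi-orderable group, an element commuting with a nontrivial power of `h`
commutes with `h`. -/
theorem IsBiOrderable.commute_of_commute_zpow {G : Type*} [Group G] (hG : IsBiOrderable G)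
    {k : ℤ} (hk : k ≠ 0) {g h : G} (hc : Commute g (h ^ k)) : Commute g h := by
  have e : g * h * g⁻¹ = h := by
    apply hG.zpow_left_injective hk
    simp only [conj_zpow]
    exact mul_inv_eq_iff_eq_mul.mpr hc.eq
  exact mul_inv_eq_iff_eq_mul.mp e

/-- In a bi-orderable group, the isolator of an abelian subgroup is an abelian subgroup:
it is closed under multiplication and inverses, and all of its elements commute. -/
theorem isolator_of_abelian_is_abelian_subgroup {G : Type*} [Group G]
    (hG : IsBiOrderable G) (A : Subgroup G) (hA : ∀ a ∈ A, ∀ b ∈ A, a * b = b * a) :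
    (∀ g ∈ isolator (A : Set G), ∀ h ∈ isolator (A : Set G),
        g * h ∈ isolator (A : Set G)) ∧
    (∀ g ∈ isolator (A : Set G), g⁻¹ ∈ isolator (A : Set G)) ∧
    (∀ g ∈ isolator (A : Set G), ∀ h ∈ isolator (A : Set G), g * h = h * g) := by
  have hcomm : ∀ g ∈ isolator (A : Set G), ∀ h ∈ isolator (A : Set G), Commute g h := by
    rintro g ⟨k, hk, hgk⟩ h ⟨l, hl, hhl⟩
    have hgl : Commute (g ^ k) (h ^ l) := hA _ hgk _ hhl
    exact (hG.commute_of_commute_zpow hk (hG.commute_of_commute_zpow hl hgl).symm).symm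
  refine ⟨?_, ?_, hcomm⟩
  · intro g hg h hh
    have hgh := hcomm g hg h hh
    obtain ⟨k, hk, hgk⟩ := hg
    obtain ⟨l, hl, hhl⟩ := hh
    refine ⟨k * l, mul_ne_zero hk hl, ?_⟩
    rw [hgh.mul_zpow, zpow_mul, mul_comm k l, zpow_mul]
    exact A.mul_mem (A.zpow_mem hgk l) (A.zpow_mem hhl k)
  · rintro g ⟨k, hk, hgk⟩
    refine ⟨k, hk, ?_⟩
    rw [inv_zpow]
    exact A.inv_mem hgk
end

section
/- Every bi-orderable group G that is not isomorphic to the infinite cyclic group ℤ admits a dense left-ordering; that is, there exists a positive cone P of a left-ordering of G having no least element. -/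
/-- An abelian group containing a free abelian subgroup of rank two is densely orderable as soon as
it is torsion-free. -/
theorem exists_isDenseCone_of_linearIndependent {A : Type*} [CommGroup A] [IsMulTorsionFree A]
    {z w : A} (h : LinearIndependent ℤ ![Additive.ofMul z, Additive.ofMul w]) :
    ∃ Q : Set A, IsDenseCone Q := by
  let ι : Additive A →+ DivisibleHull (Additive A) :=
    DivisibleHull.coeAddMonoidHom _
  have hι : Function.Injective ι := DivisibleHull.coe_injective
  have hli : LinearIndependent ℚ ![ι (.ofMul z), ι (.ofMul w)] := by
    rw [← LinearIndependent.iff_fractionRing ℤ ℚ]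
    have := h.map' ι.toIntLinearMap (LinearMap.ker_eq_bot.2 hι)
    have heq : ι.toIntLinearMap ∘ ![Additive.ofMul z, Additive.ofMul w] =
        ![ι (.ofMul z), ι (.ofMul w)] := by
      ext i
      fin_cases i <;> rfl
    rwa [heq] at this
  let D := Submodule.span ℚ (Set.range ![ι (.ofMul z), ι (.ofMul w)])
  obtain ⟨f, hf⟩ := LinearMap.exists_extend ((Module.Basis.span hli).constr ℚ ![(1 : ℝ), √2])
  have hfb (i : Fin 2) : f (![ι (.ofMul z), ι (.ofMul w)] i) = ![(1 : ℝ), √2] i := by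
    have := LinearMap.congr_fun hf (Module.Basis.span hli i)
    rw [Module.Basis.constr_basis] at this
    simpa [Module.Basis.span_apply] using this
  have hfz : f (ι (.ofMul z)) = 1 := hfb 0
  have hfw : f (ι (.ofMul w)) = √2 := hfb 1
  have hfD : ∀ x ∈ D, f x = 0 → x = 0 := by
    intro x hx hfx
    simp only [D, Matrix.range_cons, Matrix.range_empty, Set.union_empty,
      Set.singleton_union] at hx
    obtain ⟨a, b, rfl⟩ := Submodule.mem_span_pair.1 hx
    rw [map_add, map_smul, map_smul, hfz, hfw, Rat.smul_def, Rat.smul_def, mul_one] at hfx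
    have hb : b = 0 := by
      by_contra hb
      refine irrational_sqrt_two ⟨-a / b, ?_⟩
      have : (b : ℝ) ≠ 0 := by exact_mod_cast hb
      push_cast
      field_simp
      linarith
    subst hb
    have ha : a = 0 := by simpa using hfx
    simp [ha]
  let B := Module.Basis.ofVectorSpace ℚ (DivisibleHull (Additive A) ⧸ D)
  classical
  let : LinearOrder (Module.Basis.ofVectorSpaceIndex ℚ (DivisibleHull (Additive A) ⧸ D)) :=
    linearOrderOfSTO WellOrderingRel
  let r : A → Lex (Module.Basis.ofVectorSpaceIndex ℚ (DivisibleHull (Additive A) ⧸ D) →₀ ℚ) :=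
    fun a ↦ toLex (B.repr (D.mkQ (ι (.ofMul a))))
  let s : A → ℝ := fun a ↦ f (ι (.ofMul a))
  have hr_mul (a b : A) : r (a * b) = r a + r b := by
    simp only [r, ofMul_mul, map_add]
    rfl
  have hs_mul (a b : A) : s (a * b) = s a + s b := by simp [s]
  have hr_one : r 1 = 0 := by simpa using hr_mul 1 1
  have hs_one : s 1 = 0 := by simpa using hs_mul 1 1
  have hr_inv (a : A) : r a⁻¹ = -r a :=
    eq_neg_of_add_eq_zero_left (by rw [← hr_mul, inv_mul_cancel, hr_one])
  have hs_inv (a : A) : s a⁻¹ = -s a :=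
    eq_neg_of_add_eq_zero_left (by rw [← hs_mul, inv_mul_cancel, hs_one])
  have hrD (a : A) : r a = 0 ↔ ι (.ofMul a) ∈ D := by
    change B.repr (D.mkQ (ι (.ofMul a))) = 0 ↔ _
    simp
  have hinj (a : A) (h₁ : r a = 0) (h₂ : s a = 0) : a = 1 :=
    hι ((hfD _ ((hrD a).1 h₁) h₂).trans (map_zero ι).symm)
  have hsmall (ε : ℝ) (hε : 0 < ε) : ∃ a, r a = 0 ∧ 0 < s a ∧ s a < ε := by
    have hd : Dense (AddSubgroup.closure {1, √2} : Set ℝ) := by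
      rw [dense_addSubgroupClosure_pair_iff]
      simpa using irrational_sqrt_two
    obtain ⟨x, hx, hx0, hxε⟩ := hd.exists_between hε
    obtain ⟨m, n, rfl⟩ := AddSubgroup.mem_closure_pair.1 hx
    have hs : s (z ^ m * w ^ n) = m • (1 : ℝ) + n • √2 := by
      simp only [s, ofMul_mul, ofMul_zpow, map_add, map_zsmul, hfz, hfw]
    refine ⟨z ^ m * w ^ n, ?_, hs ▸ hx0, hs ▸ hxε⟩
    rw [hrD]
    simp only [ofMul_mul, ofMul_zpow, map_add, map_zsmul]
    exact D.add_mem (D.toAddSubgroup.zsmul_mem (Submodule.subset_span ⟨0, rfl⟩) m)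
      (D.toAddSubgroup.zsmul_mem (Submodule.subset_span ⟨1, rfl⟩) n)
  refine ⟨{a | 0 < r a ∨ r a = 0 ∧ 0 < s a}, ⟨?_, ?_, ?_, ?_⟩, ?_⟩
  · rintro a ha b hb
    simp only [Set.mem_ofPred_eq, hr_mul, hs_mul] at *
    rcases ha with ha | ⟨ha, ha'⟩ <;> rcases hb with hb | ⟨hb, hb'⟩
    · exact .inl (add_pos ha hb)
    · exact .inl (by rwa [hb, add_zero])
    · exact .inl (by rwa [ha, zero_add])
    · exact .inr ⟨by rw [ha, hb, add_zero], add_pos ha' hb'⟩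
  · intro a
    simp only [Set.mem_ofPred_eq, hr_inv, hs_inv, Left.neg_pos_iff, neg_eq_zero]
    rcases lt_trichotomy (r a) 0 with h | h | h
    · exact .inr (.inl (.inl h))
    · rcases lt_trichotomy (s a) 0 with h' | h' | h'
      · exact .inr (.inl (.inr ⟨h, h'⟩))
      · exact .inr (.inr (hinj a h h'))
      · exact .inl (.inr ⟨h, h'⟩)
    · exact .inl (.inl h)
  · intro a
    simp only [Set.mem_ofPred_eq, hr_inv, hs_inv, Left.neg_pos_iff, neg_eq_zero]
    rintro (h | ⟨h, h'⟩) (k | ⟨k, k'⟩)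
    · exact lt_asymm h k
    · exact h.ne' k
    · exact k.ne h
    · exact lt_asymm h' k'
  · simp [hr_one, hs_one]
  · rintro ⟨p, hp, hmin⟩
    obtain ⟨a, hra, hsa, ha⟩ : ∃ a, r a = 0 ∧ 0 < s a ∧ (r p = 0 → s a < s p) := by
      rcases hp with hp | ⟨hp, hp'⟩
      · obtain ⟨a, h₁, h₂, -⟩ := hsmall 1 one_pos
        exact ⟨a, h₁, h₂, fun h ↦ absurd h hp.ne'⟩
      · obtain ⟨a, h₁, h₂, h₃⟩ := hsmall _ hp'
        exact ⟨a, h₁, h₂, fun _ ↦ h₃⟩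
    rcases hmin a (.inr ⟨hra, hsa⟩) with rfl | h
    · exact lt_irrefl _ (ha hra)
    · simp only [Set.mem_ofPred_eq, hr_mul, hs_mul, hr_inv, hs_inv, hra, add_zero,
        Left.neg_pos_iff, neg_eq_zero] at h
      rcases h with h | ⟨h, h'⟩
      · rcases hp with hp | ⟨hp, -⟩
        · exact lt_asymm h hp
        · exact h.ne hp
      · linarith [ha h]

section OrderedGroup

variable {G : Type*} [Group G] [LinearOrder G] [MulLeftMono G] [MulRightMono G]

/-- A left-ordering of the centralizer of `T` extends to one of the whole group: an element outside
of the centralizer is positive if it moves up the first element of `T` that it moves at all. -/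
theorem exists_isDenseCone_of_centralizer (T : Set G) {Q : Set (Subgroup.centralizer T)}
    (hQ : IsDenseCone Q) (hne : Q.Nonempty) : ∃ P : Set G, IsDenseCone P := by
  let up : Set G := {g | ∃ t ∈ T, t < g * t * g⁻¹ ∧ ∀ u ∈ T, WellOrderingRel u t → g * u * g⁻¹ = u}
  obtain ⟨⟨hQmul, hQtri, hQinv, hQone⟩, hQmin⟩ := hQ
  have hfix (c : Subgroup.centralizer T) {t : G} (ht : t ∈ T) : (c : G) * t * (c : G)⁻¹ = t := by
    rw [← Subgroup.mem_centralizer_iff.1 c.2 t ht, mul_inv_cancel_right]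
  have hmono (g : G) {a b : G} : g * a * g⁻¹ < g * b * g⁻¹ ↔ a < b := by simp
  have hconj (g h t : G) : g * h * t * (g * h)⁻¹ = g * (h * t * h⁻¹) * g⁻¹ := by group
  have hconj_inv (g t : G) : g * t * g⁻¹ = t ↔ g⁻¹ * t * g⁻¹⁻¹ = t := by
    rw [mul_inv_eq_iff_eq_mul, mul_inv_eq_iff_eq_mul, inv_mul_eq_iff_eq_mul, ← mul_assoc,
      eq_mul_inv_iff_mul_eq, eq_comm]
  have hup_mul {g h : G} (hg : g ∈ up) (hh : h ∈ up) : g * h ∈ up := by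
    obtain ⟨t, ht, hgt, hg⟩ := hg
    obtain ⟨u, hu, hhu, hh⟩ := hh
    rcases trichotomous_of WellOrderingRel t u with htu | rfl | htu
    · refine ⟨t, ht, by rwa [hconj, hh t ht htu], fun v hv hvt ↦ ?_⟩
      rw [hconj, hh v hv (_root_.trans hvt htu), hg v hv hvt]
    · refine ⟨t, ht, ?_, fun v hv hvt ↦ by rw [hconj, hh v hv hvt, hg v hv hvt]⟩
      rw [hconj]
      exact hgt.trans ((hmono g).2 hhu)
    · refine ⟨u, hu, ?_, fun v hv hvu ↦ ?_⟩
      · rw [hconj]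
        conv_lhs => rw [← hg u hu htu]
        exact (hmono g).2 hhu
      · rw [hconj, hh v hv hvu, hg v hv (_root_.trans hvu htu)]
  have hup_mul_coe {g : G} (c : Subgroup.centralizer T) (hg : g ∈ up) : g * c ∈ up := by
    obtain ⟨t, ht, hgt, hg⟩ := hg
    exact ⟨t, ht, by rwa [hconj, hfix c ht], fun v hv hvt ↦ by rw [hconj, hfix c hv, hg v hv hvt]⟩
  have hup_coe_mul {g : G} (c : Subgroup.centralizer T) (hg : g ∈ up) : c * g ∈ up := by
    obtain ⟨t, ht, hgt, hg⟩ := hg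
    refine ⟨t, ht, ?_, fun v hv hvt ↦ by rw [hconj, hg v hv hvt, hfix c hv]⟩
    rw [hconj]
    conv_lhs => rw [← hfix c ht]
    exact (hmono _).2 hgt
  have hup_coe (c : Subgroup.centralizer T) : (c : G) ∉ up := by
    rintro ⟨t, ht, hct, -⟩
    exact hct.ne' (hfix c ht)
  have hup_inv {g : G} (hg : g ∈ up) : g⁻¹ ∉ up := fun hg' ↦
    hup_coe 1 (by simpa using hup_mul hg hg')
  have htri (g : G) : g ∈ up ∨ g⁻¹ ∈ up ∨ g ∈ Subgroup.centralizer T := by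
    by_cases hg : g ∈ Subgroup.centralizer T
    · exact .inr (.inr hg)
    have hmoved : {t ∈ T | g * t * g⁻¹ ≠ t}.Nonempty := by
      by_contra! hempty
      refine hg (Subgroup.mem_centralizer_iff.2 fun t ht ↦ ?_)
      by_contra hgt
      exact hempty.subset (show t ∈ _ from ⟨ht, fun h ↦ hgt (mul_inv_eq_iff_eq_mul.1 h).symm⟩)
    obtain ⟨t, ⟨ht, hgt⟩, hmin⟩ :=
      (IsWellFounded.wf : WellFounded (WellOrderingRel (α := G))).has_min _ hmoved
    have hlt (u) (hu : u ∈ T) (hut : WellOrderingRel u t) : g * u * g⁻¹ = u := by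
      by_contra h
      exact hmin u ⟨hu, h⟩ hut
    rcases lt_or_gt_of_ne hgt with h | h
    · refine .inr (.inl ⟨t, ht, ?_, fun u hu hut ↦ (hconj_inv g u).1 (hlt u hu hut)⟩)
      have := (hmono g⁻¹).2 h
      rwa [← hconj, inv_mul_cancel, one_mul, inv_one, mul_one] at this
    · exact .inl ⟨t, ht, h, hlt⟩
  refine ⟨up ∪ (↑) '' Q, ⟨?_, ?_, ?_, ?_⟩, ?_⟩
  · rintro _ (ha | ⟨a, ha, rfl⟩) _ (hb | ⟨b, hb, rfl⟩)
    · exact .inl (hup_mul ha hb)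
    · exact .inl (hup_mul_coe b ha)
    · exact .inl (hup_coe_mul a hb)
    · exact .inr ⟨a * b, hQmul a ha b hb, rfl⟩
  · intro g
    rcases htri g with h | h | h
    · exact .inl (.inl h)
    · exact .inr (.inl (.inl h))
    · rcases hQtri ⟨g, h⟩ with h' | h' | h'
      · exact .inl (.inr ⟨_, h', rfl⟩)
      · exact .inr (.inl (.inr ⟨_, h', rfl⟩))
      · exact .inr (.inr (congrArg Subtype.val h'))
  · rintro g (hg | ⟨a, ha, rfl⟩) (hg' | ⟨b, hb, hbg⟩)
    · exact hup_inv hg hg'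
    · exact hup_coe b⁻¹ (by simpa [hbg] using hg)
    · exact hup_coe a⁻¹ hg'
    · obtain rfl : b = a⁻¹ := Subtype.ext hbg
      exact hQinv a ha hb
  · rintro (h | ⟨a, ha, ha'⟩)
    · exact hup_coe 1 h
    · obtain rfl : a = 1 := Subtype.ext ha'
      exact hQone ha
  · rintro ⟨p, hp | ⟨p, hp, rfl⟩, hmin⟩
    · obtain ⟨c, hc⟩ := hne
      rcases hmin c (.inr ⟨c, hc, rfl⟩) with rfl | h | ⟨d, -, hd⟩
      · exact hup_coe c hp
      · exact hup_inv hp (by simpa using hup_mul_coe c⁻¹ h)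
      · refine hup_coe (c * d⁻¹) ?_
        simpa [hd] using hp
    · refine hQmin ⟨p, hp, fun q hq ↦ ?_⟩
      rcases hmin q (.inr ⟨q, hq, rfl⟩) with h | h | ⟨d, hd, hd'⟩
      · exact .inl (Subtype.ext h)
      · exact absurd h (hup_coe (p⁻¹ * q))
      · obtain rfl : d = p⁻¹ * q := Subtype.ext hd'
        exact .inr hd

/-- The cyclic subgroup generated by a least positive element is isolated. -/
theorem mem_zpowers_of_pow_eq_zpow {z w : G} (hz : 1 < z) (hmin : ∀ g : G, 1 < g → z ≤ g)
    (hzw : Commute z w) {n : ℕ} (hn : n ≠ 0) {m : ℤ} (h : w ^ n = z ^ m) :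
    w ∈ Subgroup.zpowers z := by
  have hn' : (0 : ℤ) < n := by positivity
  have hr0 := Int.emod_nonneg m hn'.ne'
  have hrn := Int.emod_lt_of_pos m hn'
  have hm := Int.emod_add_mul_ediv m n
  obtain ⟨k, hk⟩ := Int.eq_ofNat_of_zero_le hr0
  rw [hk] at hm hrn
  have hpow : (w * z ^ (-(m / n))) ^ n = z ^ k := by
    rw [(hzw.symm.zpow_right _).mul_pow, h, ← zpow_natCast, ← zpow_mul, ← zpow_add,
      ← zpow_natCast z k]
    congr 1
    linarith
  have hone : w * z ^ (-(m / n)) = 1 := by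
    rcases lt_trichotomy (w * z ^ (-(m / n))) 1 with hlt | heq | hgt
    · have h₁ := pow_lt_one' hlt hn
      rw [hpow] at h₁
      exact absurd h₁ (one_le_pow_of_one_le' hz.le k).not_gt
    · exact heq
    · have h₁ := pow_le_pow_left' (hmin _ hgt) n
      rw [hpow] at h₁
      exact absurd h₁ (pow_lt_pow_right' hz (by exact_mod_cast hrn)).not_ge
  exact ⟨m / n, by rw [eq_comm, ← mul_inv_eq_one, ← zpow_neg, hone]⟩

open scoped IsMulCommutative in
theorem linearIndependent_of_notMem_zpowers {H : Subgroup G} [IsMulCommutative H] {z w : H}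
    (hz : 1 < (z : G)) (hmin : ∀ g : G, 1 < g → (z : G) ≤ g)
    (hw : (w : G) ∉ Subgroup.zpowers (z : G)) :
    LinearIndependent ℤ ![Additive.ofMul z, Additive.ofMul w] := by
  have hzw : Commute (z : G) w := congrArg Subtype.val (mul_comm' z w)
  rw [LinearIndependent.pair_iff]
  intro m n hmn
  have hmn' : (z : G) ^ m * (w : G) ^ n = 1 := congrArg (fun x ↦ ((Additive.toMul x : H) : G)) hmn
  have hn : n = 0 := by
    by_contra hn
    refine hw ?_
    have hwn : (w : G) ^ n = (z : G) ^ (-m) := by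
      rw [zpow_neg, eq_inv_iff_mul_eq_one, ← hmn']
      exact ((hzw.zpow_zpow m n).eq).symm
    rcases Int.natAbs_eq n with h | h
    · rw [h, zpow_natCast] at hwn
      exact mem_zpowers_of_pow_eq_zpow hz hmin hzw (Int.natAbs_ne_zero.2 hn) hwn
    · rw [h, zpow_neg, zpow_natCast, zpow_neg, inv_inj] at hwn
      exact mem_zpowers_of_pow_eq_zpow hz hmin hzw (Int.natAbs_ne_zero.2 hn) hwn
  refine ⟨?_, hn⟩
  rw [hn, zpow_zero, mul_one] at hmn'
  exact (IsMulTorsionFree.zpow_eq_one_iff_right hz.ne').1 hmn'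

theorem commute_of_least {z : G} (hz : 1 < z) (hmin : ∀ g : G, 1 < g → z ≤ g) (g : G) :
    Commute g z := by
  have hle (g : G) : z ≤ g * z * g⁻¹ := hmin _ (by
    rw [← mul_inv_cancel g]
    exact mul_lt_mul_left (lt_mul_of_one_lt_right' g hz) g⁻¹)
  have h₁ : z * g ≤ g * z := le_mul_inv_iff_mul_le.1 (hle g)
  have h₂ : g * z ≤ z * g := by
    have := hle g⁻¹
    rwa [inv_inv, mul_assoc, le_inv_mul_iff_mul_le] at this
  exact le_antisymm h₂ h₁

open scoped IsMulCommutative in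
theorem exists_isDenseCone_of_linearOrder (hnZ : ¬ Nonempty (G ≃* Multiplicative ℤ)) :
    ∃ P : Set G, IsDenseCone P := by
  by_cases hleast : ∃ z : G, 1 < z ∧ ∀ g : G, 1 < g → z ≤ g
  · obtain ⟨z, hz, hmin⟩ := hleast
    obtain ⟨w, hw⟩ : ∃ w : G, w ∉ Subgroup.zpowers z := by
      by_contra! hall
      have hinj : Function.Injective (zpowersHom G z) :=
        injective_zpow_iff_not_isOfFinOrder.2 (not_isOfFinOrder_of_isMulTorsionFree hz.ne')
      exact hnZ ⟨(MulEquiv.ofBijective (M := Multiplicative ℤ) (zpowersHom G z) ⟨hinj, hall⟩).symm⟩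
    let T : Set G := Subgroup.centralizer {w}
    have hwT : w ∈ T := Subgroup.mem_centralizer_singleton_iff.2 rfl
    let A := Subgroup.centralizer T
    have : IsMulCommutative A := ⟨⟨fun a b ↦ Subtype.ext <|
      Subgroup.mem_centralizer_iff.1 b.2 a <| Subgroup.mem_centralizer_singleton_iff.2
        (Subgroup.mem_centralizer_iff.1 a.2 w hwT).symm⟩⟩
    have hzA : z ∈ A := Subgroup.mem_centralizer_iff.2 fun t _ ↦ commute_of_least hz hmin t
    have hwA : w ∈ A := Subgroup.mem_centralizer_iff.2 fun t ht ↦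
      Subgroup.mem_centralizer_singleton_iff.1 ht
    obtain ⟨Q, hQ⟩ := exists_isDenseCone_of_linearIndependent
      (linearIndependent_of_notMem_zpowers (H := A) (z := ⟨z, hzA⟩) (w := ⟨w, hwA⟩) hz hmin hw)
    refine exists_isDenseCone_of_centralizer T hQ ?_
    rcases hQ.1.2.1 ⟨z, hzA⟩ with h | h | h
    · exact ⟨_, h⟩
    · exact ⟨_, h⟩
    · exact absurd (congrArg Subtype.val h) hz.ne'
  · refine ⟨{g | 1 < g}, ⟨fun a ha b hb ↦ one_lt_mul' ha hb, fun g ↦ ?_, fun g hg hg' ↦ ?_,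
      lt_irrefl 1⟩, ?_⟩
    · rcases lt_trichotomy g 1 with h | h | h
      · exact .inr (.inl (Left.one_lt_inv_iff.2 h))
      · exact .inr (.inr h)
      · exact .inl h
    · exact lt_asymm hg (Left.one_lt_inv_iff.1 hg')
    · rintro ⟨p, hp, hmin⟩
      refine hleast ⟨p, hp, fun g hg ↦ ?_⟩
      rcases hmin g hg with rfl | h
      · exact le_rfl
      · exact (lt_inv_mul_iff_lt.1 h).le

end OrderedGroup

/-- The left-invariant linear order determined by a positive cone. -/
noncomputable abbrev IsLeftCone.linearOrder {G : Type*} [Group G] {P : Set G} (hP : IsLeftCone P) :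
    LinearOrder G where
  le a b := a = b ∨ a⁻¹ * b ∈ P
  le_refl _ := .inl rfl
  le_trans := by
    rintro a b c (rfl | hab) (rfl | hbc)
    · exact .inl rfl
    · exact .inr hbc
    · exact .inr hab
    · exact .inr (by simpa [mul_assoc] using hP.1 _ hab _ hbc)
  le_antisymm := by
    rintro a b (rfl | hab) (h | hba)
    · rfl
    · rfl
    · exact h.symm
    · exact absurd (by simpa using hba) (hP.2.2.1 _ hab)
  le_total a b := by
    rcases hP.2.1 (a⁻¹ * b) with h | h | h
    · exact .inl (.inr h)
    · exact .inr (.inr (by simpa using h))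
    · exact .inl (.inl (inv_mul_eq_one.1 h))
  toDecidableLE := Classical.decRel _

/-- Every bi-orderable group not isomorphic to the integers admits a dense left-ordering. -/
theorem biorderable_admits_dense_ordering {G : Type*} [Group G]
    (hG : IsBiOrderable G) (hnZ : ¬ Nonempty (G ≃* Multiplicative ℤ)) :
    ∃ P : Set G, IsDenseCone P := by
  obtain ⟨P, hP, hconj⟩ := hG
  let := hP.linearOrder
  have : MulLeftMono G := ⟨fun g a b hab ↦ by
    rcases hab with rfl | h
    · exact le_rfl
    · exact .inr (by simpa [mul_assoc] using h)⟩
  have : MulRightMono G := ⟨fun g a b hab ↦ by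
    rcases hab with rfl | h
    · exact le_rfl
    · exact .inr (by simpa [mul_assoc] using hconj g⁻¹ _ h)⟩
  exact exists_isDenseCone_of_linearOrder hnZ
end

section
/- Let n ≥ 2 and let F_n be the free group on n generators. Let P be a positive cone of a left-ordering of F_n and let g_1, …, g_m be finitely many elements of P. Then there exists a positive cone Q of a left-ordering of F_n with g_i ∈ Q for all i, and a subgroup C of F_n with g_i ∉ C for all i, such that: (1) C is convex relative to the ordering determined by Q; and (2) C is nontrivial and not isomorphic to ℤ. -/
/-- A finite strictly monotone relation between countable dense linear orders without endpoints
extends to an order isomorphism. -/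
theorem exists_orderIso_extending {α β : Type*} [LinearOrder α] [LinearOrder β]
    [Countable α] [DenselyOrdered α] [NoMinOrder α] [NoMaxOrder α] [Nonempty α]
    [Countable β] [DenselyOrdered β] [NoMinOrder β] [NoMaxOrder β] [Nonempty β]
    (s : Finset (α × β)) (hs : ∀ p ∈ s, ∀ q ∈ s, p.1 < q.1 ↔ p.2 < q.2) :
    ∃ e : α ≃o β, ∀ p ∈ s, e p.1 = p.2 := by
  cases nonempty_encodable α
  cases nonempty_encodable β
  let f₀ : Order.PartialIso α β := ⟨s, fun p hp q hq => by
    simp only [cmp, cmpUsing, hs p hp q hq, hs q hq p hp]⟩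
  let D : α ⊕ β → Order.Cofinal (Order.PartialIso α β) := fun p =>
    Sum.recOn p (Order.PartialIso.definedAtLeft β) (Order.PartialIso.definedAtRight α)
  let I := Order.idealOfCofinals f₀ D
  let F a := Order.PartialIso.funOfIdeal a I (Order.cofinal_meets_idealOfCofinals _ D (Sum.inl a))
  let G b := Order.PartialIso.invOfIdeal b I (Order.cofinal_meets_idealOfCofinals _ D (Sum.inr b))
  refine ⟨OrderIso.ofCmpEqCmp (fun a => (F a).val) (fun b => (G b).val) fun a b => ?_,
    fun p hp => ?_⟩
  · obtain ⟨f, hf, ha⟩ := (F a).prop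
    obtain ⟨g, hg, hb⟩ := (G b).prop
    obtain ⟨m, _, fm, gm⟩ := I.directed _ hf _ hg
    exact m.prop (a, _) (fm ha) (_, b) (gm hb)
  · change (F p.1).val = p.2
    obtain ⟨f, hf, ha⟩ := (F p.1).prop
    obtain ⟨m, _, fm, gm⟩ := I.directed _ hf _ (Order.mem_idealOfCofinals f₀ D)
    exact (cmp_eq_eq_iff _ _).1 ((m.prop _ (fm ha) p (gm hp)).symm.trans (cmp_self_eq_eq p.1))

namespace IsLeftCone

variable {G : Type*} [Group G] {P : Set G}

/-- The order of a left-ordered countable group embeds in the rationals. -/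
theorem exists_embedding_rat [Countable G] (hP : IsLeftCone P) :
    ∃ φ : G → ℚ, ∀ x y, φ x < φ y ↔ x⁻¹ * y ∈ P := by
  classical
  obtain ⟨hmul, htri, hinv, hone⟩ := hP
  let : LinearOrder G :=
    { le x y := x = y ∨ x⁻¹ * y ∈ P
      lt x y := x⁻¹ * y ∈ P
      le_refl x := Or.inl rfl
      le_trans := by
        rintro x y z (rfl | hxy) (rfl | hyz)
        · exact Or.inl rfl
        · exact Or.inr hyz
        · exact Or.inr hxy
        · exact Or.inr (by simpa [mul_assoc] using hmul _ hxy _ hyz)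
      lt_iff_le_not_ge := by
        intro x y
        constructor
        · intro h
          refine ⟨Or.inr h, ?_⟩
          rintro (rfl | h')
          · exact hone (by simpa using h)
          · exact hinv _ h (by simpa using h')
        · rintro ⟨rfl | h, h'⟩
          · exact absurd (Or.inl rfl) h'
          · exact h
      le_antisymm := by
        rintro x y (rfl | h) (h' | h')
        · rfl
        · rfl
        · exact h'.symm
        · exact absurd (by simpa using h') (hinv _ h)
      le_total := by
        intro x y
        rcases htri (x⁻¹ * y) with h | h | h
        · exact Or.inl (Or.inr h)
        · exact Or.inr (Or.inr (by simpa using h))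
        · exact Or.inl (Or.inl (inv_mul_eq_one.1 h))
      toDecidableLE := Classical.decRel _ }
  obtain ⟨φ⟩ := Order.embedding_from_countable_to_dense (α := G) (β := ℚ)
  exact ⟨φ, fun x y => φ.lt_iff_lt⟩

variable {X : Type*} [LinearOrder X]

/-- An action on a linear order with a base point induces a left-ordering, ties at the base point
being broken by a given left-ordering. -/
theorem of_action (hP : IsLeftCone P) (ψ : G →* (X ≃o X)) (x : X) :
    IsLeftCone {g | x < ψ g x ∨ ψ g x = x ∧ g ∈ P} := by
  obtain ⟨hmul, htri, hinv, hone⟩ := hP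
  have inv_lt (g : G) : x < ψ g⁻¹ x ↔ ψ g x < x := by
    rw [← (ψ g).lt_iff_lt, ← RelIso.mul_apply, ← map_mul]; simp
  have inv_eq (g : G) : ψ g⁻¹ x = x ↔ ψ g x = x := by
    rw [← (ψ g).injective.eq_iff, ← RelIso.mul_apply, ← map_mul]; simp [eq_comm]
  refine ⟨?_, ?_, ?_, ?_⟩
  · rintro a ha b hb
    simp only [Set.mem_ofPred_eq, map_mul, RelIso.mul_apply] at ha hb ⊢
    rcases hb with hb | ⟨hb, hbP⟩
    · have := (ψ a).lt_iff_lt.2 hb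
      rcases ha with ha | ⟨ha, -⟩
      · exact Or.inl (ha.trans this)
      · exact Or.inl (by rwa [ha] at this)
    · rw [hb]
      exact ha.imp_right fun h => ⟨h.1, hmul _ h.2 _ hbP⟩
  · intro g
    simp only [Set.mem_ofPred_eq, inv_lt, inv_eq]
    rcases lt_trichotomy x (ψ g x) with h | h | h
    · exact Or.inl (Or.inl h)
    · rcases htri g with h' | h' | h'
      · exact Or.inl (Or.inr ⟨h.symm, h'⟩)
      · exact Or.inr (Or.inl (Or.inr ⟨h.symm, h'⟩))
      · exact Or.inr (Or.inr h')
    · exact Or.inr (Or.inl (Or.inl h))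
  · intro g hg
    simp only [Set.mem_ofPred_eq, inv_lt, inv_eq] at hg ⊢
    rcases hg with h | ⟨h, hg⟩
    · rintro (h' | h')
      · exact lt_asymm h h'
      · exact h.ne' h'.1
    · rintro (h' | h')
      · exact h'.ne h
      · exact hinv _ hg h'.2
  · simp [hone]

end IsLeftCone

/-- The stabilizer of the base point is convex in the left-ordering induced by an action. -/
theorem isConvexSubgroup_stabilizer {G X : Type*} [Group G] [LinearOrder X] (P : Set G)
    (ψ : G →* (X ≃o X)) (x : X) :
    IsConvexSubgroup {g | x < ψ g x ∨ ψ g x = x ∧ g ∈ P}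
      ((MulAction.stabilizer (X ≃o X) x).comap ψ) := by
  have le_of_mem (g f : G) (h : g⁻¹ * f ∈ {g | x < ψ g x ∨ ψ g x = x ∧ g ∈ P}) :
      ψ g x ≤ ψ f x := by
    have h' : x ≤ ψ (g⁻¹ * f) x := h.elim le_of_lt fun h => h.1.ge
    rw [← (ψ g).le_iff_le, ← RelIso.mul_apply, ← map_mul] at h'
    simpa using h'
  intro g hg h hh f hgf hfh
  replace hg : ψ g x = x := hg
  replace hh : ψ h x = x := hh
  have h₁ := le_of_mem _ _ hgf
  have h₂ := le_of_mem _ _ hfh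
  rw [hg] at h₁
  rw [hh] at h₂
  exact le_antisymm h₂ h₁

/-- `FollowsOn φ U ψ` says that the action `ψ` of a free group imitates, along `φ`, left
multiplication by each generator within `U`. -/
def FollowsOn {α X : Type*} [LinearOrder X] (φ : FreeGroup α → X) (U : Finset (FreeGroup α))
    (ψ : FreeGroup α →* (X ≃o X)) : Prop :=
  ∀ r, ∀ y ∈ U, FreeGroup.of r * y ∈ U →
    ψ (FreeGroup.of r) (φ y) = φ (FreeGroup.of r * y)

/-- `IsTraceable φ U` says that for every action imitating left multiplication within `U`, the
orbit map of `φ 1` agrees with `φ` on `U`. -/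
def IsTraceable {α X : Type*} [LinearOrder X] (φ : FreeGroup α → X)
    (U : Finset (FreeGroup α)) : Prop :=
  ∀ ψ : FreeGroup α →* (X ≃o X), FollowsOn φ U ψ → ∀ u ∈ U, ψ u (φ 1) = φ u

namespace IsTraceable

variable {α X : Type*} [LinearOrder X] {φ : FreeGroup α → X}

theorem singleton_one : IsTraceable φ {1} := by
  intro ψ _ u hu
  simp [Finset.mem_singleton.1 hu]

theorem biUnion [DecidableEq α] {ι : Type*} (s : Finset ι) (U : ι → Finset (FreeGroup α))
    (h : ∀ i ∈ s, IsTraceable φ (U i)) : IsTraceable φ (s.biUnion U) := by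
  intro ψ hψ u hu
  obtain ⟨i, hi, hu⟩ := Finset.mem_biUnion.1 hu
  have hsub := Finset.subset_biUnion_of_mem U hi
  exact h i hi ψ (fun r y hy hry => hψ r y (hsub hy) (hsub hry)) u hu

theorem insert_mul [DecidableEq α] {U : Finset (FreeGroup α)} (hU : IsTraceable φ U)
    {h : FreeGroup α} (hh : h ∈ U) {g : FreeGroup α}
    (hg : ∃ r, g = FreeGroup.of r ∨ g = (FreeGroup.of r)⁻¹) :
    IsTraceable φ (insert (g * h) U) := by
  intro ψ hψ u hu
  have hold : ∀ u ∈ U, ψ u (φ 1) = φ u := hU ψ fun r y hy hry =>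
    hψ r y (Finset.mem_insert_of_mem hy) (Finset.mem_insert_of_mem hry)
  rcases Finset.mem_insert.1 hu with rfl | hu
  · rw [map_mul, RelIso.mul_apply, hold h hh]
    obtain ⟨r, rfl | rfl⟩ := hg
    · exact hψ r h (Finset.mem_insert_of_mem hh) (Finset.mem_insert_self _ _)
    · have := hψ r ((FreeGroup.of r)⁻¹ * h) (Finset.mem_insert_self _ _) (by simp [hh])
      rw [mul_inv_cancel_left] at this
      rw [← this, ← RelIso.mul_apply, ← map_mul]
      simp
  · exact hold u hu

theorem exists_mem_mul (g : FreeGroup α) :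
    ∀ h : FreeGroup α, (∃ U, IsTraceable φ U ∧ h ∈ U) → ∃ U, IsTraceable φ U ∧ g * h ∈ U := by
  classical
  induction g using FreeGroup.induction_on with
  | C1 => simp
  | of r =>
    rintro h ⟨U, hU, hh⟩
    exact ⟨_, hU.insert_mul hh ⟨r, Or.inl rfl⟩, Finset.mem_insert_self _ _⟩
  | inv_of r _ =>
    rintro h ⟨U, hU, hh⟩
    exact ⟨_, hU.insert_mul hh ⟨r, Or.inr rfl⟩, Finset.mem_insert_self _ _⟩
  | mul g₁ g₂ ih₁ ih₂ =>
    intro h hh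
    rw [mul_assoc]
    exact ih₁ _ (ih₂ _ hh)

/-- Every finite set of words lies in a finite traceable set. -/
theorem exists_superset (s : Finset (FreeGroup α)) : ∃ U, IsTraceable φ U ∧ s ⊆ U := by
  classical
  have key (g : FreeGroup α) : ∃ U, IsTraceable φ U ∧ g ∈ U := by
    simpa using exists_mem_mul g 1 ⟨_, singleton_one (φ := φ), Finset.mem_singleton_self 1⟩
  choose U hU hmem using key
  exact ⟨s.biUnion U, biUnion s U fun g _ => hU g, fun g hg =>
    Finset.mem_biUnion.2 ⟨g, hg, hmem g⟩⟩

end IsTraceable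

/-- In a free group, a generator does not commute with its conjugate by another generator or by
the inverse of another generator. -/
theorem FreeGroup.not_commute_conj {α : Type*} {i j : α} (hij : i ≠ j) {c : FreeGroup α}
    (hc : c = FreeGroup.of j ∨ c = (FreeGroup.of j)⁻¹) :
    ¬ Commute (FreeGroup.of i) (c⁻¹ * FreeGroup.of i * c) := by
  classical
  intro h
  have h' := congrArg (FreeGroup.lift fun k : α =>
    if k = i then Equiv.swap (0 : Fin 3) 1 else finRotate 3) h.eq
  rcases hc with rfl | rfl <;>
  · simp only [_root_.map_mul, _root_.map_inv, lift_apply_of, if_true, if_neg hij.symm] at h'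
    revert h'
    decide

/-- Given a left-ordering of a free group and a finite set of words, there is an action on the
rationals that orders these words relative to a base point as the left-ordering does, while the
stabilizer of the base point is not commutative. -/
theorem exists_action_noncommutative_stabilizer {α : Type*} [Countable α] {i j : α} (hij : i ≠ j)
    {P : Set (FreeGroup α)} (hP : IsLeftCone P) (s : Finset (FreeGroup α)) :
    ∃ (ψ : FreeGroup α →* (ℚ ≃o ℚ)) (x : ℚ), (∀ g ∈ s, g ∈ P → x < ψ g x) ∧
      ∃ k₁ k₂, ψ k₁ x = x ∧ ψ k₂ x = x ∧ ¬ Commute k₁ k₂ := by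
  classical
  obtain ⟨φ, hφ⟩ := hP.exists_embedding_rat
  have hφmul (g x y : FreeGroup α) : φ (g * x) < φ (g * y) ↔ φ x < φ y := by
    rw [hφ, hφ]; simp [mul_assoc]
  obtain ⟨U, hU, hsU⟩ := IsTraceable.exists_superset (φ := φ) (insert 1 s)
  obtain ⟨t, htU, ht⟩ := U.exists_max_image φ ⟨1, hsU (Finset.mem_insert_self _ _)⟩
  obtain ⟨c, hc, hct⟩ : ∃ c, (c = FreeGroup.of j ∨ c = (FreeGroup.of j)⁻¹) ∧
      φ t < φ (c * t) := by
    rcases lt_trichotomy (φ t) (φ (FreeGroup.of j * t)) with h | h | h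
    · exact ⟨_, Or.inl rfl, h⟩
    · rcases hP.2.1 (t⁻¹ * (FreeGroup.of j * t)) with h' | h' | h'
      · exact absurd h ((hφ _ _).2 h').ne
      · exact absurd h ((hφ _ _).2 (by simpa [mul_assoc] using h')).ne'
      · simp [inv_mul_eq_one] at h'
    · refine ⟨_, Or.inr rfl, ?_⟩
      rw [← hφmul (FreeGroup.of j)]
      simpa using h
  have hcct : φ (c * t) < φ (c * (c * t)) := (hφmul _ _ _).2 hct
  let S := U ∪ {t, c * t, c * (c * t)}
  have hE (r : α) : ∃ e : ℚ ≃o ℚ, ∀ y ∈ S, e (φ y) = φ (FreeGroup.of r * y) := by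
    obtain ⟨e, he⟩ := exists_orderIso_extending
      (S.image fun y => (φ y, φ (FreeGroup.of r * y))) (by
        simp only [Finset.mem_image]
        rintro _ ⟨y, _, rfl⟩ _ ⟨z, _, rfl⟩
        exact (hφmul _ _ _).symm)
    exact ⟨e, fun y hy => he _ (Finset.mem_image_of_mem _ hy)⟩
  choose E hE using hE
  obtain ⟨A, hAU, hA₁, hA₂⟩ : ∃ A : ℚ ≃o ℚ,
      (∀ y ∈ U, FreeGroup.of i * y ∈ U → A (φ y) = φ (FreeGroup.of i * y)) ∧
      A (φ (c * t)) = φ (c * t) ∧ A (φ (c * (c * t))) = φ (c * (c * t)) := by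
    obtain ⟨A, hA⟩ := exists_orderIso_extending
      (((U.filter fun y => FreeGroup.of i * y ∈ U).image fun y =>
        (φ y, φ (FreeGroup.of i * y))) ∪
        {(φ (c * t), φ (c * t)), (φ (c * (c * t)), φ (c * (c * t)))}) (by
        simp only [Finset.mem_union, Finset.mem_image, Finset.mem_filter, Finset.mem_insert,
          Finset.mem_singleton]
        rintro _ (⟨y, ⟨hy, hy'⟩, rfl⟩ | rfl | rfl) _ (⟨z, ⟨hz, hz'⟩, rfl⟩ | rfl | rfl)
        · exact (hφmul _ _ _).symm
        all_goals
          try have := ht _ hy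
          try have := ht _ hy'
          try have := ht _ hz
          try have := ht _ hz'
          grind)
    refine ⟨A, fun y hy hy' => hA (_, _) ?_, hA (_, _) ?_, hA (_, _) ?_⟩
    · exact Finset.mem_union_left _
        (Finset.mem_image.2 ⟨y, Finset.mem_filter.2 ⟨hy, hy'⟩, rfl⟩)
    · simp
    · simp
  let ψ : FreeGroup α →* (ℚ ≃o ℚ) := FreeGroup.lift fun r => if r = i then A else E r
  have hψi : ψ (FreeGroup.of i) = A := by simp [ψ]
  have hψ (r : α) (hr : r ≠ i) : ψ (FreeGroup.of r) = E r := by simp [ψ, hr]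
  have hfollow : FollowsOn φ U ψ := by
    intro r y hy hry
    by_cases hr : r = i
    · subst hr
      rw [hψi, hAU y hy hry]
    · rw [hψ r hr, hE r y (Finset.mem_union_left _ hy)]
  have htrace := hU ψ hfollow
  have hψc (y : FreeGroup α) (hy : y ∈ S) (hcy : c * y ∈ S) : ψ c (φ y) = φ (c * y) := by
    rcases hc with rfl | rfl
    · rw [hψ j hij.symm, hE j y hy]
    · have := hE j _ hcy
      rw [mul_inv_cancel_left, ← hψ j hij.symm] at this
      rw [← this, ← RelIso.mul_apply, ← map_mul]
      simp
  have hc₁ : ψ (c * t) (φ 1) = φ (c * t) := by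
    rw [map_mul, RelIso.mul_apply, htrace t htU]
    exact hψc t (by simp [S]) (by simp [S])
  have hc₂ : ψ (c * (c * t)) (φ 1) = φ (c * (c * t)) := by
    rw [map_mul, RelIso.mul_apply, hc₁]
    exact hψc _ (by simp [S]) (by simp [S])
  have hfix (w : FreeGroup α) (hw : ψ w (φ 1) = φ w) (hAw : A (φ w) = φ w) :
      ψ (w⁻¹ * FreeGroup.of i * w) (φ 1) = φ 1 := by
    rw [map_mul, map_mul, RelIso.mul_apply, RelIso.mul_apply, hw, hψi, hAw, ← hw,
      ← RelIso.mul_apply, ← map_mul]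
    simp
  refine ⟨ψ, φ 1, fun g hg hgP => ?_, _, _, hfix _ hc₁ hA₁, hfix _ hc₂ hA₂, fun h => ?_⟩
  · rw [htrace g (hsU (Finset.mem_insert_of_mem hg)), hφ]
    simpa using hgP
  · refine FreeGroup.not_commute_conj hij hc ?_
    have := h.map (MulAut.conj (c * t)).toMonoidHom
    simpa [mul_assoc] using this

/-- For the free group `F_n` (`n ≥ 2`): given a positive cone `P` and finitely many elements
`g 0, …, g (m-1)` of `P`, there is a positive cone `Q` containing all `g i` admitting a
convex subgroup `C`, avoiding all the `g i`, that is nontrivial and not isomorphic to `ℤ`. -/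
theorem free_group_convex_subgroup_approx {n : ℕ} (hn : 2 ≤ n)
    (P : Set (FreeGroup (Fin n))) (hP : IsLeftCone P)
    (m : ℕ) (g : Fin m → FreeGroup (Fin n)) (hg : ∀ i, g i ∈ P) :
    ∃ Q : Set (FreeGroup (Fin n)), IsLeftCone Q ∧ (∀ i, g i ∈ Q) ∧
      ∃ C : Subgroup (FreeGroup (Fin n)), (∀ i, g i ∉ C) ∧
        IsConvexSubgroup Q C ∧ C ≠ ⊥ ∧ ¬ Nonempty (C ≃* Multiplicative ℤ) := by
  classical
  have hij : (⟨0, by lia⟩ : Fin n) ≠ ⟨1, by lia⟩ := by simp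
  obtain ⟨ψ, x, hs, k₁, k₂, hk₁, hk₂, hk⟩ :=
    exists_action_noncommutative_stabilizer hij hP (Finset.univ.image g)
  have hgx (i : Fin m) : x < ψ (g i) x :=
    hs _ (Finset.mem_image_of_mem _ (Finset.mem_univ i)) (hg i)
  refine ⟨_, hP.of_action ψ x, fun i => Or.inl (hgx i), _, fun i hi => (hgx i).ne' hi,
    isConvexSubgroup_stabilizer P ψ x, fun hbot => ?_, ?_⟩
  · have h₁ : k₁ ∈ (MulAction.stabilizer (ℚ ≃o ℚ) x).comap ψ := hk₁
    rw [hbot, Subgroup.mem_bot] at h₁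
    exact hk (h₁ ▸ Commute.one_left k₂)
  · rintro ⟨e⟩
    have hcomm : Commute (⟨k₁, hk₁⟩ : (MulAction.stabilizer (ℚ ≃o ℚ) x).comap ψ) ⟨k₂, hk₂⟩ :=
      e.injective (by rw [map_mul, map_mul, mul_comm])
    exact hk (hcomm.map (Subgroup.subtype _))
end

section
/- Let F_∞ be the free group on countably infinitely many generators. Then for every positive cone P of а left-ordering of F_∞ and every finite subset S ⊆ P there exists a positive cone Q ≠ P of a left-ordering of F_∞ with S ⊆ Q. (That is, LO(F_∞) has no isolated points.) -/
/-- The preimage of a positive cone under an injective homomorphism is a positive cone. -/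
theorem IsLeftCone.preimage {G H : Type*} [Group G] [Group H] {P : Set H} (hP : IsLeftCone P)
    (f : G →* H) (hf : Function.Injective f) : IsLeftCone (f ⁻¹' P) := by
  obtain ⟨hmul, htot, hinv, hone⟩ := hP
  refine ⟨fun a ha b hb => ?_, fun g => ?_, fun g hg => ?_, ?_⟩
  · simpa using hmul _ ha _ hb
  · simpa [map_eq_one_iff f hf] using htot (f g)
  · simpa using hinv _ hg
  · simpa using hone

/-- The endomorphism of a free group inverting the generator `a` and fixing the others. -/
def FreeGroup.invertGenerator {α : Type*} [DecidableEq α] (a : α) : FreeGroup α →* FreeGroup α :=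
  FreeGroup.lift fun i => if i = a then (FreeGroup.of i)⁻¹ else FreeGroup.of i

theorem FreeGroup.invertGenerator_involutive {α : Type*} [DecidableEq α] (a : α) :
    Function.Involutive (FreeGroup.invertGenerator a) := by
  have h : (FreeGroup.invertGenerator a).comp (FreeGroup.invertGenerator a) = MonoidHom.id _ := by
    ext i
    by_cases hi : i = a <;> simp [FreeGroup.invertGenerator, hi]
  exact DFunLike.congr_fun h

/-- Each element of a free group is fixed by inverting any but finitely many generators. -/
theorem FreeGroup.eventually_invertGenerator_eq {α : Type*} [DecidableEq α] (g : FreeGroup α) :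
    ∀ᶠ a in Filter.cofinite, FreeGroup.invertGenerator a g = g := by
  induction g using FreeGroup.induction_on with
  | C1 => simp
  | of i =>
    filter_upwards [(Set.finite_singleton i).compl_mem_cofinite] with a ha
    have hia : i ≠ a := fun h => ha h.symm
    simp [FreeGroup.invertGenerator, hia]
  | inv_of i h => filter_upwards [h] with a ha using by rw [_root_.map_inv, ha]
  | mul x y hx hy => filter_upwards [hx, hy] with a hxa hya using by rw [_root_.map_mul, hxa, hya]

/-- The space of left-orderings of the free group on countably many generators has no
isolated points. -/
theorem free_group_inf_no_isolated_points
    (P : Set (FreeGroup ℕ)) (hP : IsLeftCone P)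
    (S : Finset (FreeGroup ℕ)) (hS : ↑S ⊆ P) :
    ∃ Q : Set (FreeGroup ℕ), Q ≠ P ∧ IsLeftCone Q ∧ ↑S ⊆ Q := by
  obtain ⟨n, hn⟩ := ((Filter.eventually_all_finset S).2 fun g _ =>
    FreeGroup.eventually_invertGenerator_eq g).exists
  refine ⟨FreeGroup.invertGenerator n ⁻¹' P, fun hQ => ?_,
    hP.preimage _ (FreeGroup.invertGenerator_involutive n).injective, fun g hg => ?_⟩
  · have hflip : (FreeGroup.of n)⁻¹ ∈ P ↔ FreeGroup.of n ∈ P := by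
      simpa [FreeGroup.invertGenerator] using Set.ext_iff.1 hQ (FreeGroup.of n)
    rcases hP.2.1 (FreeGroup.of n) with h | h | h
    · exact hP.2.2.1 _ h (hflip.2 h)
    · exact hP.2.2.1 _ (hflip.1 h) h
    · exact FreeGroup.of_ne_one n h
  · rw [Set.mem_preimage, hn g hg]
    exact hS hg
end

section
/- Let F_∞ be the free group on countably infinitely many generators. Then for every positive cone P of a left-ordering of F_∞ and every finite subset S ⊆ P there exists a positive cone Q of a dense left-ordering of F_∞ with S ⊆ Q. (That is, LO(F_∞) equals the closure of the set D(F_∞) of dense orderings.) -/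
/-- The lexicographic cone obtained by pulling `P` back along a sequence of endomorphisms: `g` is
positive when the first nontrivial `ρ k g` lies in `P`. -/
def lexCone {G : Type*} [Group G] (P : Set G) (ρ : ℕ → G →* G) : Set G :=
  {g | ∃ k, ρ k g ∈ P ∧ ∀ j < k, ρ j g = 1}

theorem isLeftCone_lexCone {G : Type*} [Group G] {P : Set G} (hP : IsLeftCone P)
    {ρ : ℕ → G →* G} (hρ : ∀ g, ∃ k, ρ k g = g) : IsLeftCone (lexCone P ρ) := by
  obtain ⟨hmul, htri, hinv, hone⟩ := hP
  refine ⟨?_, ?_, ?_, ?_⟩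
  · rintro a ⟨k, hak, ha⟩ b ⟨l, hbl, hb⟩
    rcases lt_trichotomy k l with h | rfl | h
    · exact ⟨k, by simpa [hb k h] using hak,
        fun j hj => by simp [ha j hj, hb j (hj.trans h)]⟩
    · exact ⟨k, by simpa using hmul _ hak _ hbl, fun j hj => by simp [ha j hj, hb j hj]⟩
    · exact ⟨l, by simpa [ha l h] using hbl,
        fun j hj => by simp [hb j hj, ha j (hj.trans h)]⟩
  · intro g
    classical
    by_cases hg : g = 1
    · exact Or.inr (Or.inr hg)
    have hex : ∃ k, ρ k g ≠ 1 := by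
      obtain ⟨k, hk⟩ := hρ g
      exact ⟨k, by rwa [hk]⟩
    have hmin : ∀ j < Nat.find hex, ρ j g = 1 := fun j hj => not_not.mp (Nat.find_min hex hj)
    rcases htri (ρ (Nat.find hex) g) with h | h | h
    · exact Or.inl ⟨_, h, hmin⟩
    · exact Or.inr (Or.inl ⟨_, by simpa using h, fun j hj => by simp [hmin j hj]⟩)
    · exact absurd h (Nat.find_spec hex)
  · rintro g ⟨k, hgk, hg⟩ ⟨l, hgl, hg'⟩
    rw [map_inv] at hgl
    rcases lt_trichotomy k l with h | rfl | h
    · have := hg' k h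
      rw [map_inv, inv_eq_one] at this
      exact hone (this ▸ hgk)
    · exact hinv _ hgk hgl
    · rw [hg l h, inv_one] at hgl
      exact hone hgl
  · rintro ⟨k, hk, -⟩
    exact hone (by simpa using hk)

theorem isDenseCone_lexCone {G : Type*} [Group G] {P : Set G} (hP : IsLeftCone P)
    {ρ : ℕ → G →* G} (hρ : ∀ g, ∃ k, ρ k g = g)
    (hker : ∀ k, ∃ g ≠ 1, ∀ j ≤ k, ρ j g = 1) : IsDenseCone (lexCone P ρ) := by
  have hQ := isLeftCone_lexCone hP hρ
  refine ⟨hQ, ?_⟩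
  rintro ⟨p, hpQ, hleast⟩
  obtain ⟨k, hpk, hp⟩ := id hpQ
  obtain ⟨q, hqQ, hq⟩ : ∃ q ∈ lexCone P ρ, ∀ j ≤ k, ρ j q = 1 := by
    obtain ⟨g, hg1, hg⟩ := hker k
    rcases hQ.2.1 g with h | h | h
    · exact ⟨g, h, hg⟩
    · exact ⟨g⁻¹, h, fun j hj => by simp [hg j hj]⟩
    · exact absurd h hg1
  rcases hleast q hqQ with rfl | h
  · exact hP.2.2.2 (hq k le_rfl ▸ hpk)
  · refine hQ.2.2.1 _ h ⟨k, ?_, fun j hj => ?_⟩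
    · simpa [hq k le_rfl] using hpk
    · simp [hq j hj.le, hp j hj]

/-- The endomorphism of the free group on `ℕ` killing every generator of index at least `n`. -/
def FreeGroup.truncate (n : ℕ) : FreeGroup ℕ →* FreeGroup ℕ :=
  FreeGroup.lift fun i => if i < n then FreeGroup.of i else 1

theorem FreeGroup.truncate_of (n i : ℕ) :
    FreeGroup.truncate n (FreeGroup.of i) = if i < n then FreeGroup.of i else 1 := by
  simp [FreeGroup.truncate]

theorem FreeGroup.eventually_truncate_eq (g : FreeGroup ℕ) :
    ∀ᶠ n in Filter.atTop, FreeGroup.truncate n g = g := by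
  induction g using FreeGroup.induction_on with
  | C1 => simp
  | of i =>
    filter_upwards [Filter.eventually_gt_atTop i] with n hn
    simp [FreeGroup.truncate_of, hn]
  | inv_of i ih => exact ih.mono fun n hn => by rw [_root_.map_inv, hn]
  | mul x y hx hy => filter_upwards [hx, hy] with n hnx hny using by rw [_root_.map_mul, hnx, hny]

/-- For the free group on countably many generators, `LO(F_∞)` is the closure of the set of
dense orderings. -/
theorem free_group_inf_LO_eq_closure_dense
    (P : Set (FreeGroup ℕ)) (hP : IsLeftCone P)
    (S : Finset (FreeGroup ℕ)) (hS : ↑S ⊆ P) :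
    ∃ Q : Set (FreeGroup ℕ), IsDenseCone Q ∧ ↑S ⊆ Q := by
  obtain ⟨n, hn⟩ := ((Filter.eventually_all_finset S).2
    fun s _ => FreeGroup.eventually_truncate_eq s).exists
  refine ⟨lexCone P fun k => FreeGroup.truncate (n + k), isDenseCone_lexCone hP ?_ ?_, ?_⟩
  · intro g
    obtain ⟨m, hm⟩ := Filter.eventually_atTop.1 (FreeGroup.eventually_truncate_eq g)
    exact ⟨m, hm _ (Nat.le_add_left m n)⟩
  · intro k
    refine ⟨FreeGroup.of (n + k), FreeGroup.of_ne_one _, fun j hj => ?_⟩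
    rw [FreeGroup.truncate_of, if_neg (by omega)]
  · intro s hs
    exact ⟨0, by simpa [hn s hs] using hS hs, fun j hj => absurd hj (Nat.not_lt_zero j)⟩
end

section
/- Let A be a nontrivial torsion-free abelian group. Then A is not isomorphic to ℤ if and only if for every positive cone P of a left-ordering of A and every finite subset S ⊆ P there exists a positive cone Q of a dense left-ordering of A with S ⊆ Q. (That is, for abelian groups, the closure of D(A) equals LO(A) if and only if A is not isomorphic to the integers.) -/
/-- A positive cone of an abelian group is the positive part of an embedding into an ordered
rational vector space. -/
theorem IsLeftCone.exists_addMonoidHom_rat_module.{u} {A : Type u} [CommGroup A] {P : Set A}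
    (hP : IsLeftCone P) :
    ∃ (V : Type u) (_ : AddCommGroup V) (_ : Module ℚ V) (_ : LinearOrder V)
      (_ : IsOrderedAddMonoid V) (_ : IsStrictOrderedModule ℚ V) (ι : Additive A →+ V),
      ∀ a : A, a ∈ P ↔ 0 < ι (Additive.ofMul a) := by
  classical
  obtain ⟨hmul, htri, hinv, hone⟩ := hP
  let _ : LinearOrder A :=
    { le := fun a b => a = b ∨ a⁻¹ * b ∈ P
      le_refl := fun a => Or.inl rfl
      le_trans := by
        rintro a b c (rfl | h) (rfl | h')
        · exact Or.inl rfl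
        · exact Or.inr h'
        · exact Or.inr h
        · exact Or.inr (by simpa [mul_assoc] using hmul _ h _ h')
      le_antisymm := by
        rintro a b (rfl | h) (h' | h')
        · rfl
        · rfl
        · exact h'.symm
        · exact absurd h' (by simpa using hinv _ h)
      le_total := by
        intro a b
        rcases htri (a⁻¹ * b) with h | h | h
        · exact Or.inl (Or.inr h)
        · exact Or.inr (Or.inr (by simpa using h))
        · exact Or.inl (Or.inl (inv_mul_eq_one.1 h))
      toDecidableLE := Classical.decRel _ }
  have : IsOrderedMonoid A :=
    { mul_le_mul_left := by
        rintro a b (rfl | h) c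
        · exact le_rfl
        · refine Or.inr ?_
          have : (a * c)⁻¹ * (b * c) = a⁻¹ * b := by
            rw [mul_inv_rev, mul_comm b c, mul_comm c⁻¹ a⁻¹, mul_assoc, inv_mul_cancel_left]
          rwa [this] }
  refine ⟨DivisibleHull (Additive A), inferInstance, inferInstance, inferInstance, inferInstance,
    inferInstance, DivisibleHull.coeAddMonoidHom (Additive A), fun a => ?_⟩
  have hle : (1 : A) < a ↔ a ∈ P := by
    rw [lt_iff_le_and_ne]
    constructor
    · rintro ⟨rfl | h, hne⟩
      · exact absurd rfl hne
      · simpa using h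
    · intro h
      exact ⟨Or.inr (by simpa using h), fun h1 => hone (h1 ▸ h)⟩
  rw [← hle]
  change _ ↔ 0 < DivisibleHull.mk (Additive.ofMul a) 1
  rw [← DivisibleHull.mk_zero 1, DivisibleHull.mk_lt_mk]
  simp only [PNat.val_ofNat, one_smul]
  rfl

/-- An intersection of finitely many open half-lines of the real line that is nonempty by
pairwise comparison contains points outside any given countable set. -/
theorem exists_forall_pos_affine_notMem {α : Type*} (T : Finset α) (f : α → ℝ) (c : α → ℚ)
    (h0 : ∀ t ∈ T, c t = 0 → 0 < f t)
    (h : ∀ t ∈ T, ∀ u ∈ T, 0 < c t → c u < 0 → 0 < -(c u : ℝ) * f t + c t * f u)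
    {D : Set ℝ} (hD : D.Countable) :
    ∃ r ∉ D, ∀ t ∈ T, 0 < f t + r * c t := by
  classical
  obtain ⟨m, hlo, hhi⟩ := Order.exists_between_finsets
    ((T.filter fun t => 0 < c t).image fun t => -f t / c t)
    ((T.filter fun t => c t < 0).image fun t => -f t / c t) (by
      intro x hx y hy
      simp only [Finset.mem_image, Finset.mem_filter] at hx hy
      obtain ⟨t, ⟨ht, hct⟩, rfl⟩ := hx
      obtain ⟨u, ⟨hu, hcu⟩, rfl⟩ := hy
      have := h t ht u hu hct hcu
      have hct' : (0 : ℝ) < c t := by exact_mod_cast hct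
      have hcu' : (c u : ℝ) < 0 := by exact_mod_cast hcu
      rw [← neg_div_neg_eq (-f u), neg_neg, div_lt_div_iff₀ hct' (by linarith)]
      linarith)
  have hopen : IsOpen {r : ℝ | ∀ t ∈ T, 0 < f t + r * c t} := by
    have : {r : ℝ | ∀ t ∈ T, 0 < f t + r * c t} = ⋂ t ∈ T, {r : ℝ | 0 < f t + r * c t} := by
      ext; simp
    rw [this]
    exact isOpen_biInter_finset fun t _ => isOpen_lt (by fun_prop) (by fun_prop)
  obtain ⟨r, hr, hrD⟩ := (hD.dense_compl ℝ).inter_open_nonempty _ hopen ⟨m, by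
    intro t ht
    rcases lt_trichotomy (c t) 0 with hc | hc | hc
    · have := hhi _ (Finset.mem_image_of_mem _ (Finset.mem_filter.2 ⟨ht, hc⟩))
      have hc' : (c t : ℝ) < 0 := by exact_mod_cast hc
      rw [lt_div_iff_of_neg hc'] at this
      linarith
    · simpa [hc] using h0 t ht hc
    · have := hlo _ (Finset.mem_image_of_mem _ (Finset.mem_filter.2 ⟨ht, hc⟩))
      have hc' : (0 : ℝ) < c t := by exact_mod_cast hc
      rw [div_lt_iff₀ hc'] at this
      linarith⟩
  exact ⟨r, hrD, hr⟩

/-- Finitely many positive vectors of a finite-dimensional subspace of an ordered rational vector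
space are positive for some real linear functional that is injective on the subspace. -/
theorem exists_linearMap_real_pos_injOn {V : Type*} [AddCommGroup V] [Module ℚ V] [LinearOrder V]
    [IsOrderedAddMonoid V] [IsStrictOrderedModule ℚ V] (s : Finset V) :
    ∀ T : Finset V, (∀ t ∈ T, 0 < t) → (∀ t ∈ T, t ∈ Submodule.span ℚ (s : Set V)) →
      ∃ θ : V →ₗ[ℚ] ℝ, (∀ t ∈ T, 0 < θ t) ∧
        ∀ x ∈ Submodule.span ℚ (s : Set V), θ x = 0 → x = 0 := by
  classical
  induction s using Finset.induction_on with
  | empty =>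
    intro T hpos hT
    refine ⟨0, fun t ht => ?_, fun x hx _ => by simpa using hx⟩
    have h0 : t = 0 := by simpa using hT t ht
    exact absurd (hpos t ht) (by simp [h0])
  | insert v s _ ih =>
    intro T hpos hT
    by_cases hv : v ∈ Submodule.span ℚ (s : Set V)
    · have : Submodule.span ℚ ((insert v s : Finset V) : Set V) = Submodule.span ℚ (s : Set V) := by
        rw [Finset.coe_insert, Submodule.span_insert_eq_span hv]
      rw [this] at hT ⊢
      exact ih T hpos hT
    obtain ⟨c, hcv, hc⟩ := Submodule.exists_le_ker_of_notMem hv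
    have hker : ∀ x ∈ Submodule.span ℚ ((insert v s : Finset V) : Set V), c x = 0 →
        x ∈ Submodule.span ℚ (s : Set V) := by
      intro x hx hx0
      rw [Finset.coe_insert, Submodule.mem_span_insert] at hx
      obtain ⟨a, z, hz, rfl⟩ := hx
      have hcz : c z = 0 := hc hz
      have ha : a = 0 := by simpa [hcz, hcv] using hx0
      simpa [ha] using hz
    obtain ⟨θ, hθ, hinj⟩ := ih
      (T.filter (fun t => c t = 0) ∪
        ((T ×ˢ T).filter fun p => 0 < c p.1 ∧ c p.2 < 0).image
          fun p => -c p.2 • p.1 + c p.1 • p.2)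
      (by
        intro t ht
        simp only [Finset.mem_union, Finset.mem_filter, Finset.mem_image, Finset.mem_product] at ht
        rcases ht with ht | ⟨p, ⟨⟨h1, h2⟩, h3, h4⟩, rfl⟩
        · exact hpos t ht.1
        · exact add_pos (smul_pos (by linarith) (hpos _ h1)) (smul_pos h3 (hpos _ h2)))
      (by
        intro t ht
        simp only [Finset.mem_union, Finset.mem_filter, Finset.mem_image, Finset.mem_product] at ht
        rcases ht with ht | ⟨p, ⟨⟨h1, h2⟩, h3, h4⟩, rfl⟩
        · exact hker t (hT t ht.1) ht.2
        · refine hker _ (add_mem (Submodule.smul_mem _ _ (hT _ h1))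
            (Submodule.smul_mem _ _ (hT _ h2))) ?_
          simp only [map_add, map_smul, smul_eq_mul]
          ring)
    let W := Submodule.span ℚ ((insert v s : Finset V) : Set V)
    have hWc : (W : Set V).Countable := by
      have : Countable W := by
        have : Module.Finite ℚ W := inferInstance
        exact (Module.finBasis ℚ W).equivFun.toEquiv.countable_iff.2 inferInstance
      exact Set.to_countable _
    obtain ⟨r, hr, hrT⟩ := exists_forall_pos_affine_notMem T θ c
      (fun t ht h0 => hθ t (by simp [ht, h0]))
      (fun t ht u hu h1 h2 => by
        have := hθ (-c u • t + c t • u) (Finset.mem_union_right _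
          (Finset.mem_image.2 ⟨(t, u), by simp [ht, hu, h1, h2], rfl⟩))
        simpa [Rat.smul_def] using this)
      (hWc.image θ)
    refine ⟨θ + (LinearMap.toSpanSingleton ℚ ℝ r).comp c, fun t ht => ?_, fun x hx hx0 => ?_⟩
    · simpa [Rat.smul_def, mul_comm] using hrT t ht
    · have hx0' : θ x + c x * r = 0 := by simpa [Rat.smul_def] using hx0
      by_cases hcx : c x = 0
      · exact hinj x (hker x hx hcx) (by simpa [hcx] using hx0')
      · refine absurd ⟨-(c x)⁻¹ • x, Submodule.smul_mem _ _ hx, ?_⟩ hr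
        have : (c x : ℝ) ≠ 0 := by exact_mod_cast hcx
        simp only [map_smul, Rat.smul_def]
        push_cast
        field_simp
        linarith

/-- In a non-cyclic subgroup of a rational vector space, every finite subset is contained in a
finitely generated subspace meeting the subgroup in a non-cyclic group. -/
theorem exists_finset_span_not_cyclic {B V : Type*} [AddCommGroup B] [Nontrivial B]
    [AddCommGroup V] [Module ℚ V] (ι : B →+ V)
    (hB : ∀ q : B, ∃ b, ∀ k : ℤ, b ≠ k • q) (S : Finset V) :
    ∃ S' : Finset V, S ⊆ S' ∧
      ∀ q : B, ∃ b, ι b ∈ Submodule.span ℚ (S' : Set V) ∧ ∀ k : ℤ, b ≠ k • q := by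
  classical
  obtain ⟨a, ha⟩ := exists_ne (0 : B)
  by_cases hall : ∀ b, ι b ∈ Submodule.span ℚ {ι a}
  · refine ⟨insert (ι a) S, Finset.subset_insert _ _, fun q => ?_⟩
    obtain ⟨b, hb⟩ := hB q
    exact ⟨b, Submodule.span_mono (by simp) (hall b), hb⟩
  · push Not at hall
    obtain ⟨z, hz⟩ := hall
    refine ⟨insert (ι a) (insert (ι z) S), fun x hx => by simp [hx], fun q => ?_⟩
    by_contra! hcon
    obtain ⟨m, hm⟩ := hcon a (Submodule.subset_span (by simp))
    obtain ⟨n, hn⟩ := hcon z (Submodule.subset_span (by simp))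
    have hm0 : (m : ℚ) ≠ 0 := by
      rintro h
      have : m = 0 := by exact_mod_cast h
      exact ha (by simpa [this] using hm)
    refine hz (Submodule.mem_span_singleton.2 ⟨n / m, ?_⟩)
    rw [hm, hn, map_zsmul, map_zsmul, ← Int.cast_smul_eq_zsmul ℚ, ← Int.cast_smul_eq_zsmul ℚ,
      smul_smul, div_mul_cancel₀ _ hm0]

/-- A nontrivial torsion-free group all of whose elements are powers of one element is infinite
cyclic. -/
theorem nonempty_mulEquiv_int_of_forall_zpow {A : Type*} [CommGroup A] [Nontrivial A]
    (hTF : ∀ a : A, a ≠ 1 → ¬ IsOfFinOrder a) {q : A} (hq : ∀ a, ∃ k : ℤ, a = q ^ k) :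
    Nonempty (A ≃* Multiplicative ℤ) := by
  have hq1 : q ≠ 1 := by
    rintro rfl
    obtain ⟨a, ha⟩ := exists_ne (1 : A)
    obtain ⟨k, hk⟩ := hq a
    exact ha (by simpa using hk)
  refine ⟨(MulEquiv.ofBijective (zpowersHom A q) ⟨fun m n h => ?_, fun a => ?_⟩).symm⟩
  · exact injective_zpow_iff_not_isOfFinOrder.2 (hTF q hq1) h
  · obtain ⟨k, hk⟩ := hq a
    exact ⟨Multiplicative.ofAdd k, hk.symm⟩

theorem IsLeftCone.coneHasLeast_of_mulEquiv_int {A : Type*} [CommGroup A]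
    (e : A ≃* Multiplicative ℤ) {Q : Set A} (hQ : IsLeftCone Q) : ConeHasLeast Q := by
  obtain ⟨hmul, htri, hinv, hone⟩ := hQ
  have hgen : ∀ a : A, ∃ k : ℤ, a = e.symm (Multiplicative.ofAdd 1) ^ k := fun a =>
    ⟨(e a).toAdd, by rw [← map_zpow, ← ofAdd_zsmul]; simp⟩
  obtain ⟨h, hh, hgen⟩ : ∃ h ∈ Q, ∀ a : A, ∃ k : ℤ, a = h ^ k := by
    rcases htri (e.symm (Multiplicative.ofAdd 1)) with h | h | h
    · exact ⟨_, h, hgen⟩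
    · refine ⟨_, h, fun a => ?_⟩
      obtain ⟨k, hk⟩ := hgen a
      exact ⟨-k, by simpa using hk⟩
    · simp at h
  have hpow : ∀ n : ℕ, h ^ (n + 1) ∈ Q := by
    intro n
    induction n with
    | zero => simpa using hh
    | succ n ih => rw [pow_succ]; exact hmul _ ih _ hh
  refine ⟨h, hh, fun q hq => ?_⟩
  obtain ⟨k, rfl⟩ := hgen q
  obtain ⟨n, rfl | rfl⟩ := k.eq_nat_or_neg
  · rcases n with _ | _ | n
    · exact absurd (by simpa using hq) hone
    · left; simp
    · right
      have : h⁻¹ * h ^ ((n + 1 + 1 : ℕ) : ℤ) = h ^ (n + 1) := by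
        rw [zpow_natCast, pow_succ' h (n + 1), inv_mul_cancel_left]
      rw [this]; exact hpow n
  · rcases n with _ | n
    · exact absurd (by simpa using hq) hone
    · exact absurd (by rwa [zpow_neg, zpow_natCast] at hq) (hinv _ (hpow n))

/-- The lexicographic combination of a functional with values in an ordered group and a real
functional, jointly injective, is a positive cone. -/
theorem isLeftCone_lex {A V : Type*} [CommGroup A] [AddCommGroup V] [LinearOrder V]
    [IsOrderedAddMonoid V] (f : Additive A →+ V) (g : Additive A →+ ℝ)
    (hfg : ∀ a, f a = 0 → g a = 0 → a = 0) :
    IsLeftCone {a : A | 0 < f (.ofMul a) ∨ f (.ofMul a) = 0 ∧ 0 < g (.ofMul a)} := by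
  refine ⟨?_, fun a => ?_, ?_, by simp⟩
  · rintro a (ha | ⟨ha, ha'⟩) b (hb | ⟨hb, hb'⟩)
    · exact Or.inl (by simpa using add_pos ha hb)
    · exact Or.inl (by simpa [hb] using ha)
    · exact Or.inl (by simpa [ha] using hb)
    · exact Or.inr ⟨by simp [ha, hb], by simpa using add_pos ha' hb'⟩
  · simp only [Set.mem_ofPred_eq, ofMul_inv, map_neg, Left.neg_pos_iff, neg_eq_zero]
    rcases lt_trichotomy (f (.ofMul a)) 0 with h | h | h
    · exact Or.inr (Or.inl (Or.inl h))
    · rcases lt_trichotomy (g (.ofMul a)) 0 with h' | h' | h'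
      · exact Or.inr (Or.inl (Or.inr ⟨h, h'⟩))
      · exact Or.inr (Or.inr (hfg _ h h'))
      · exact Or.inl (Or.inr ⟨h, h'⟩)
    · exact Or.inl (Or.inl h)
  · simp only [Set.mem_ofPred_eq, ofMul_inv, map_neg, Left.neg_pos_iff, neg_eq_zero]
    rintro a (ha | ⟨ha, ha'⟩) (hb | ⟨hb, hb'⟩)
    · exact lt_asymm ha hb
    · exact ha.ne' hb
    · exact hb.ne ha
    · exact (lt_asymm ha' hb')

/-- A lexicographic cone is dense when the kernel of the leading functional is not cyclic. -/
theorem isDenseCone_lex_s12 {A V : Type*} [CommGroup A] [AddCommGroup V] [LinearOrder V]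
    [IsOrderedAddMonoid V] (f : Additive A →+ V) (g : Additive A →+ ℝ)
    (hfg : ∀ a, f a = 0 → g a = 0 → a = 0)
    (hcyc : ∀ q, ∃ b, f b = 0 ∧ ∀ k : ℤ, b ≠ k • q) :
    IsDenseCone {a : A | 0 < f (.ofMul a) ∨ f (.ofMul a) = 0 ∧ 0 < g (.ofMul a)} := by
  refine ⟨isLeftCone_lex f g hfg, ?_⟩
  rintro ⟨p, hp, hmin⟩
  have hmin' : ∀ b, f b = 0 → 0 < g b → f (.ofMul p) = 0 ∧ g (.ofMul p) ≤ g b := by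
    intro b hb hgb
    rcases hmin b.toMul (Or.inr ⟨hb, hgb⟩) with h | h
    · rw [← h]; exact ⟨hb, le_rfl⟩
    · simp only [Set.mem_ofPred_eq, ofMul_mul, ofMul_inv, map_add, map_neg, ofMul_toMul, hb,
        add_zero, Left.neg_pos_iff, neg_eq_zero] at h
      rcases hp with hp | hp
      · rcases h with h | h
        · exact absurd hp h.not_gt
        · exact absurd h.1 hp.ne'
      · rcases h with h | h
        · exact absurd hp.1 h.ne
        · exact ⟨hp.1, by linarith [h.2]⟩
  obtain ⟨b, hb, hb0⟩ := hcyc 0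
  have hgb : g b ≠ 0 := fun h => hb0 0 (by simpa using hfg b hb h)
  have hfp : f (.ofMul p) = 0 := by
    rcases hgb.lt_or_gt with h | h
    · exact (hmin' (-b) (by simp [hb]) (by simpa using h)).1
    · exact (hmin' b hb h).1
  have hgp : 0 < g (.ofMul p) := by
    rcases hp with hp | hp
    · exact absurd hfp hp.ne'
    · exact hp.2
  obtain ⟨b, hb, hbk⟩ := hcyc (.ofMul p)
  obtain ⟨k, ⟨hk0, hk1⟩, -⟩ := existsUnique_zsmul_near_of_pos hgp (g b)
  have hf : f (b - k • .ofMul p) = 0 := by simp [hb, hfp]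
  have hg : g (b - k • .ofMul p) = g b - k • g (.ofMul p) := by simp
  rcases hk0.eq_or_lt with h | h
  · exact hbk k (sub_eq_zero.1 (hfg _ hf (by rw [hg, h, sub_self])))
  · have := (hmin' _ hf (by rw [hg]; exact sub_pos.2 h)).2
    rw [hg] at this
    rw [add_smul, one_smul] at hk1
    linarith

/-- For a nontrivial torsion-free abelian group `A`, the closure of the set of dense
orderings is all of `LO(A)` if and only if `A` is not isomorphic to the integers. -/
theorem abelian_closure_dense_iff_not_int {A : Type*} [CommGroup A] [Nontrivial A]
    (hTF : ∀ a : A, a ≠ 1 → ¬ IsOfFinOrder a) :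
    (¬ Nonempty (A ≃* Multiplicative ℤ)) ↔
      (∀ P : Set A, IsLeftCone P → ∀ S : Finset A, ↑S ⊆ P →
        ∃ Q : Set A, IsDenseCone Q ∧ ↑S ⊆ Q) := by
  classical
  constructor
  · intro hA P hP S hS
    obtain ⟨V, _, _, _, _, _, ι, hι⟩ := hP.exists_addMonoidHom_rat_module
    have hinj : Function.Injective ι := by
      refine (injective_iff_map_eq_zero ι).2 fun a ha => ?_
      rcases hP.2.1 a.toMul with h | h | h
      · exact absurd ((hι _).1 h) (by simp [ha])
      · exact absurd ((hι _).1 h) (by simp [ha])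
      · exact h
    have hB : ∀ q : Additive A, ∃ b, ∀ k : ℤ, b ≠ k • q := by
      intro q
      by_contra! h
      exact hA (nonempty_mulEquiv_int_of_forall_zpow hTF (q := q.toMul) h)
    obtain ⟨S', hSS', hS'⟩ := exists_finset_span_not_cyclic ι hB
      (S.image fun a => ι (.ofMul a))
    have hspan : ∀ a ∈ S, ι (.ofMul a) ∈ Submodule.span ℚ (S' : Set V) := fun a ha =>
      Submodule.subset_span (hSS' (Finset.mem_image_of_mem _ ha))
    obtain ⟨θ, hθ, hθinj⟩ := exists_linearMap_real_pos_injOn S'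
      (S.image fun a => ι (.ofMul a))
      (by simpa using fun a ha => (hι a).1 (hS ha))
      (by simpa using hspan)
    obtain ⟨σ, hσ⟩ := LinearMap.exists_rightInverse_of_surjective
      (Submodule.mkQ (Submodule.span ℚ (S' : Set V)))
      (LinearMap.range_eq_top.2 (Submodule.mkQ_surjective _))
    have hσinj : Function.Injective σ := fun x y h => by
      simpa [h] using (LinearMap.congr_fun hσ x).symm.trans
        ((congrArg _ h).trans (LinearMap.congr_fun hσ y))
    let π : V →ₗ[ℚ] V := σ.comp (Submodule.mkQ _)
    have hπ : ∀ x, π x = 0 ↔ x ∈ Submodule.span ℚ (S' : Set V) := fun x => by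
      rw [LinearMap.comp_apply, map_eq_zero_iff σ hσinj, Submodule.mkQ_apply,
        Submodule.Quotient.mk_eq_zero]
    refine ⟨_, isDenseCone_lex_s12 (π.toAddMonoidHom.comp ι) (θ.toAddMonoidHom.comp ι) ?_ ?_, ?_⟩
    · intro a h1 h2
      exact (map_eq_zero_iff ι hinj).1 (hθinj _ ((hπ _).1 h1) h2)
    · intro q
      obtain ⟨b, hb, hbk⟩ := hS' q
      exact ⟨b, (hπ _).2 hb, hbk⟩
    · intro a ha
      exact Or.inr ⟨(hπ _).2 (hspan a ha), hθ _ (Finset.mem_image_of_mem _ ha)⟩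
  · rintro h ⟨e⟩
    have hcone : IsLeftCone {a : A | 0 < (e a).toAdd} := by
      refine ⟨fun a ha b hb => ?_, fun a => ?_, fun a ha => ?_, by simp⟩
      · simpa using add_pos (show 0 < (e a).toAdd from ha) (show 0 < (e b).toAdd from hb)
      · rcases lt_trichotomy (e a).toAdd 0 with h | h | h
        · exact Or.inr (Or.inl (by simpa using h))
        · exact Or.inr (Or.inr (by simpa using h))
        · exact Or.inl h
      · simpa using le_of_lt (show 0 < (e a).toAdd from ha)
    obtain ⟨Q, hQ, -⟩ := h _ hcone ∅ (by simp)
    exact hQ.2 (hQ.1.coneHasLeast_of_mulEquiv_int e)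
end

section
/- Let G be a group admitting a bi-invariant strict total order (i.e., G is bi-ordered), let g, h ∈ G, and let n, m be nonzero integers. If g^n and h^m commute, then g and h commute. -/
theorem rel_pow_succ_of_rel {G : Type*} [Monoid G] {r : G → G → Prop} [IsTrans G r]
    (hleft : ∀ a b c : G, r a b → r (c * a) (c * b))
    (hright : ∀ a b c : G, r a b → r (a * c) (b * c))
    {a b : G} (hab : r a b) (k : ℕ) : r (a ^ (k + 1)) (b ^ (k + 1)) := by
  induction k with
  | zero => simpa using hab
  | succ k ih =>
    rw [pow_succ a (k + 1), pow_succ b (k + 1)]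
    exact trans_of r (hright _ _ a ih) (hleft _ _ _ hab)

theorem zpow_left_injective_of_biordered {G : Type*} [Group G]
    {r : G → G → Prop} [IsStrictTotalOrder G r]
    (hleft : ∀ a b c : G, r a b → r (c * a) (c * b))
    (hright : ∀ a b c : G, r a b → r (a * c) (b * c))
    {n : ℤ} (hn : n ≠ 0) : Function.Injective fun a : G => a ^ n := by
  have key : ∀ k : ℕ, ∀ a b : G, a ^ (k + 1) = b ^ (k + 1) → a = b := by
    intro k a b hab
    rcases trichotomous_of r a b with h | h | h
    · have hlt := rel_pow_succ_of_rel hleft hright h k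
      rw [hab] at hlt
      exact (irrefl_of r _ hlt).elim
    · exact h
    · have hlt := rel_pow_succ_of_rel hleft hright h k
      rw [hab] at hlt
      exact (irrefl_of r _ hlt).elim
  intro a b hab
  obtain ⟨k, hk⟩ := Nat.exists_eq_succ_of_ne_zero (Int.natAbs_ne_zero.mpr hn)
  apply key k
  rw [← Nat.succ_eq_add_one, ← hk]
  rcases Int.natAbs_eq n with h | h
  · simp only at hab
    rw [h] at hab
    simpa only [zpow_natCast, Int.natAbs_natCast] using hab
  · simp only at hab
    rw [h] at hab
    simpa only [zpow_neg, zpow_natCast, inv_inj] using hab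

theorem commute_of_zpow_left_injective {G : Type*} [Group G] {n : ℤ}
    (hn : Function.Injective fun a : G => a ^ n) {a b : G} (h : Commute (a ^ n) b) :
    Commute a b := by
  have hconj : b * a * b⁻¹ = a := hn <| by
    simp only [conj_zpow]
    rw [← h.eq, mul_inv_cancel_right]
  exact (mul_inv_eq_iff_eq_mul.mp hconj).symm

/-- In a bi-ordered group, if nonzero powers `g ^ n` and `h ^ m` commute then `g` and `h`
commute. -/
theorem commute_of_zpow_commute_biordered {G : Type*} [Group G]
    (r : G → G → Prop) (hto : IsStrictTotalOrder G r)
    (hleft : ∀ a b c : G, r a b → r (c * a) (c * b))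
    (hright : ∀ a b c : G, r a b → r (a * c) (b * c))
    (g h : G) (n m : ℤ) (hn : n ≠ 0) (hm : m ≠ 0)
    (hcomm : g ^ n * h ^ m = h ^ m * g ^ n) :
    g * h = h * g := by
  have hinj {k : ℤ} (hk : k ≠ 0) : Function.Injective fun a : G => a ^ k :=
    zpow_left_injective_of_biordered hleft hright hk
  have hg : Commute g (h ^ m) := commute_of_zpow_left_injective (hinj hn) hcomm
  exact (commute_of_zpow_left_injective (hinj hm) hg.symm).symm
end

section
/- Let G be a group with a bi-ordering < whose positive cone P = {g ∈ G : 1 < g} has a least element g (that is, the bi-ordering is discrete with least positive element g). Then g is central in G: gh = hg for all h ∈ G. -/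
/-- If a bi-ordering of `G` is discrete with least positive element `g`, then `g` is
central in `G`. -/
theorem least_positive_element_central {G : Type*} [Group G]
    (r : G → G → Prop) (hto : IsStrictTotalOrder G r)
    (hleft : ∀ a b c : G, r a b → r (c * a) (c * b))
    (hright : ∀ a b c : G, r a b → r (a * c) (b * c))
    (g : G) (hg : r 1 g) (hleast : ∀ q : G, r 1 q → q = g ∨ r g q) :
    ∀ h : G, g * h = h * g := by
  have conj_lt : ∀ a b k : G, r a b → r (k * a * k⁻¹) (k * b * k⁻¹) := fun a b k hab =>
    hright _ _ _ (hleft _ _ _ hab)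
  have conj_pos : ∀ k : G, r 1 (k * g * k⁻¹) := fun k => by
    simpa using conj_lt 1 g k hg
  intro h
  rcases hleast _ (conj_pos h) with heq | hlt
  · exact (mul_inv_eq_iff_eq_mul.mp heq).symm
  · have hback : r (h⁻¹ * g * h) g := by
      simpa [mul_assoc] using conj_lt _ _ h⁻¹ hlt
    rcases hleast (h⁻¹ * g * h) (by simpa using conj_pos h⁻¹) with heq | hlt'
    · rw [heq] at hback
      exact absurd hback (irrefl_of r g)
    · exact absurd (trans_of r hlt' hback) (irrefl_of r g)
end

section
/- Let G be a group, let P be a positive cone of a left-ordering of G, let C be a subgroup of G that is convex relative to P, and let Q be any positive cone of a left-ordering of C (viewed as a subset of G). Then P' = (P \ (P ∩ C)) ∪ Q is a positive cone of a left-ordering of G, and C is convex relative to P'. -/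
/-- `Q` is the positive cone of a left-ordering of the subset `X` of `G` (viewed inside
`G`): `Q ⊆ X`, `Q` is closed under multiplication, and every element of `X` is in exactly
one of `Q`, `Q⁻¹`, `{1}`. -/
def IsLeftConeOn {G : Type*} [Group G] (X : Set G) (Q : Set G) : Prop :=
  Q ⊆ X ∧
  (∀ a ∈ Q, ∀ b ∈ Q, a * b ∈ Q) ∧
  (∀ g ∈ X, g ∈ Q ∨ g⁻¹ ∈ Q ∨ g = 1) ∧
  (∀ g ∈ Q, g⁻¹ ∉ Q) ∧
  (1 : G) ∉ Q

theorem IsConvexSubgroup.mul_mem_cone_of_left_mem {G : Type*} [Group G] {P : Set G}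
    (hP : IsLeftCone P) {C : Subgroup G} (hC : IsConvexSubgroup P C) {c p : G}
    (hc : c ∈ C) (hp : p ∈ P) (hpC : p ∉ C) : c * p ∈ P := by
  rcases hP.2.1 (c * p) with h | h | h
  · exact h
  · exact absurd (hC 1 C.one_mem c⁻¹ (C.inv_mem hc) p (by simpa using hp)
      (by simpa using h)) hpC
  · exact absurd ((C.mul_mem_cancel_left hc).1 (h ▸ C.one_mem)) hpC

theorem IsConvexSubgroup.mul_mem_cone_of_right_mem {G : Type*} [Group G] {P : Set G}
    (hP : IsLeftCone P) {C : Subgroup G} (hC : IsConvexSubgroup P C) {c p : G}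
    (hc : c ∈ C) (hp : p ∈ P) (hpC : p ∉ C) : p * c ∈ P := by
  rcases hP.2.1 (p * c) with h | h | h
  · exact h
  · exact absurd (C.inv_mem_iff.1 (hC c hc 1 C.one_mem p⁻¹ (by simpa using h)
      (by simpa using hp))) hpC
  · exact absurd ((C.mul_mem_cancel_right hc).1 (h ▸ C.one_mem)) hpC

theorem IsConvexSubgroup.mul_notMem {G : Type*} [Group G] {P : Set G} {C : Subgroup G}
    (hC : IsConvexSubgroup P C) {p q : G} (hp : p ∈ P) (hpC : p ∉ C) (hq : q ∈ P) :
    p * q ∉ C := fun h =>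
  hpC (hC 1 C.one_mem (p * q) h p (by simpa using hp) (by simpa using hq))

/-- Changing an ordering on a convex subgroup: if `C` is convex relative to the positive
cone `P` and `Q` is any positive cone of `C`, then `(P \ (P ∩ C)) ∪ Q` is a positive cone
of `G`, relative to which `C` is still convex. -/
theorem change_ordering_on_convex_subgroup {G : Type*} [Group G]
    (P : Set G) (hP : IsLeftCone P) (C : Subgroup G) (hconv : IsConvexSubgroup P C)
    (Q : Set G) (hQ : IsLeftConeOn (C : Set G) Q) :
    IsLeftCone ((P \ (P ∩ (C : Set G))) ∪ Q) ∧
      IsConvexSubgroup ((P \ (P ∩ (C : Set G))) ∪ Q) C := by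
  obtain ⟨hQC, hQmul, hQtri, hQinv, hQone⟩ := hQ
  have hdiff : P \ (P ∩ (C : Set G)) = P \ (C : Set G) := Set.sdiff_self_inter
  rw [hdiff]
  refine ⟨⟨?_, ?_, ?_, ?_⟩, ?_⟩
  · rintro a (⟨ha, haC⟩ | ha) b (⟨hb, hbC⟩ | hb)
    · exact .inl ⟨hP.1 a ha b hb, hconv.mul_notMem ha haC hb⟩
    · exact .inl ⟨hconv.mul_mem_cone_of_right_mem hP (hQC hb) ha haC,
        fun h => haC ((C.mul_mem_cancel_right (hQC hb)).1 h)⟩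
    · exact .inl ⟨hconv.mul_mem_cone_of_left_mem hP (hQC ha) hb hbC,
        fun h => hbC ((C.mul_mem_cancel_left (hQC ha)).1 h)⟩
    · exact .inr (hQmul a ha b hb)
  · intro g
    by_cases hg : g ∈ C
    · exact (hQtri g hg).imp .inr (.imp_left .inr)
    · exact (hP.2.1 g).imp (fun h => .inl ⟨h, hg⟩)
        (.imp_left fun h => .inl ⟨h, fun h' => hg (C.inv_mem_iff.1 h')⟩)
  · rintro g (⟨hg, hgC⟩ | hg) (⟨hg', hgC'⟩ | hg')
    · exact hP.2.2.1 g hg hg'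
    · exact hgC (C.inv_mem_iff.1 (hQC hg'))
    · exact hgC' (C.inv_mem (hQC hg))
    · exact hQinv g hg hg'
  · rintro (⟨h, -⟩ | h)
    · exact hP.2.2.2 h
    · exact hQone h
  · rintro g hg h hh f (⟨hgf, -⟩ | hgf) (⟨hfh, -⟩ | hfh)
    · exact hconv g hg h hh f hgf hfh
    · exact C.inv_mem_iff.1 ((C.mul_mem_cancel_right hh).1 (hQC hfh))
    all_goals exact (C.mul_mem_cancel_left (C.inv_mem hg)).1 (hQC hgf)
end

section
/- Let G be a group, let P be a positive cone of a left-ordering of G, and let g ∈ G. Then g ∈ P and g is the least element of P (i.e., the ordering is discrete with smallest positive element g) if and only if g ∈ P and the cyclic subgroup ⟨g⟩ is convex relative to P. -/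
theorem IsLeftCone.pow_succ_mem {G : Type*} [Group G] {P : Set G} (hP : IsLeftCone P) {g : G}
    (hg : g ∈ P) (n : ℕ) : g ^ (n + 1) ∈ P := by
  induction n with
  | zero => simpa using hg
  | succ n ih => rw [pow_succ]; exact hP.1 _ ih _ hg

theorem IsLeftCone.pos_of_zpow_mem {G : Type*} [Group G] {P : Set G} (hP : IsLeftCone P) {g : G}
    (hg : g ∈ P) {k : ℤ} (hk : g ^ k ∈ P) : 0 < k := by
  by_contra! hle
  obtain ⟨n, rfl⟩ := Int.exists_eq_neg_ofNat hle
  rw [zpow_neg, zpow_natCast] at hk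
  cases n with
  | zero => exact hP.2.2.2 (by simpa using hk)
  | succ n => exact hP.2.2.1 _ (hP.pow_succ_mem hg n) hk

/-- If `g` is the least positive element, every positive element below a power of `g` is itself
a power of `g`. -/
theorem IsLeftCone.mem_zpowers_of_lt_pow {G : Type*} [Group G] {P : Set G} (hP : IsLeftCone P)
    {g : G} (hleast : ∀ q ∈ P, q = g ∨ g⁻¹ * q ∈ P) (n : ℕ) {f : G} (hf : f ∈ P)
    (hfn : f⁻¹ * g ^ n ∈ P) : f ∈ Subgroup.zpowers g := by
  induction n generalizing f with
  | zero => exact absurd (by simpa using hfn) (hP.2.2.1 f hf)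
  | succ n ih =>
    rcases hleast f hf with rfl | h
    · exact Subgroup.mem_zpowers f
    · have hmem := ih h (by simpa [pow_succ', mul_assoc] using hfn)
      exact (Subgroup.mul_mem_cancel_left _ (inv_mem (Subgroup.mem_zpowers g))).1 hmem

/-- A left-ordering is discrete with smallest positive element `g` iff `g` is positive and
the cyclic subgroup `⟨g⟩` is convex. -/
theorem least_element_iff_cyclic_convex {G : Type*} [Group G]
    (P : Set G) (hP : IsLeftCone P) (g : G) :
    (g ∈ P ∧ ∀ q ∈ P, q = g ∨ g⁻¹ * q ∈ P) ↔
      (g ∈ P ∧ IsConvexSubgroup P (Subgroup.zpowers g)) := by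
  refine and_congr_right fun hg => ⟨fun hleast a ha b hb f haf hfb => ?_, fun hconv q hq => ?_⟩
  · obtain ⟨k, hk⟩ := Subgroup.mem_zpowers_iff.1 (mul_mem (inv_mem ha) hb)
    have hab : g ^ k ∈ P := by
      rw [hk]
      simpa [mul_assoc] using hP.1 _ haf _ hfb
    obtain ⟨n, rfl⟩ := Int.eq_ofNat_of_zero_le (hP.pos_of_zpow_mem hg hab).le
    rw [zpow_natCast] at hk
    have hmem := hP.mem_zpowers_of_lt_pow hleast n haf (by rw [hk]; simpa [mul_assoc] using hfb)
    exact (Subgroup.mul_mem_cancel_left _ (inv_mem ha)).1 hmem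
  · rcases hP.2.1 (g⁻¹ * q) with h | h | h
    · exact Or.inr h
    · rw [mul_inv_rev, inv_inv] at h
      obtain ⟨k, rfl⟩ := Subgroup.mem_zpowers_iff.1
        (hconv 1 (one_mem _) g (Subgroup.mem_zpowers g) q (by simpa using hq) h)
      have hpos := hP.pos_of_zpow_mem hg hq
      rw [← zpow_neg, ← zpow_add_one] at h
      have hlt := hP.pos_of_zpow_mem hg h
      lia
    · exact Or.inl (inv_mul_eq_one.1 h).symm
end

section
/- Let A be a torsion-free abelian group, let H be a subgroup of A, and let Q be a positive cone of a left-ordering of H. Then the set Q̄ = {a ∈ I_A(H) : a^k ∈ Q for some integer k > 0} is a positive cone of a left-ordering of the isolator subgroup I_A(H) containing Q, and it is the unique positive cone of I_A(H) containing Q. -/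
/-- The canonical extension of a positive cone `Q` of a subgroup `H` to the isolator of
`H`: those elements having some positive power in `Q`. -/
def coneExt {G : Type*} [Group G] (H : Set G) (Q : Set G) : Set G :=
  {a ∈ isolator H | ∃ k : ℤ, 0 < k ∧ a ^ k ∈ Q}

theorem zpow_mem_of_mul_mem {G : Type*} [Group G] {P : Set G}
    (hP : ∀ a ∈ P, ∀ b ∈ P, a * b ∈ P) {a : G} (ha : a ∈ P) {k : ℤ} (hk : 0 < k) :
    a ^ k ∈ P := by
  induction k, (show (1 : ℤ) ≤ k from hk) using Int.leInduction with
  | base => simpa using ha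
  | succ n hn ih =>
    rw [zpow_add_one]
    exact hP _ (ih hn) _ ha

theorem mem_coneExt_of_zpow_mem {G : Type*} [Group G] {H Q : Set G} (hQH : Q ⊆ H)
    {a : G} {k : ℤ} (hk : 0 < k) (ha : a ^ k ∈ Q) : a ∈ coneExt H Q :=
  ⟨⟨k, hk.ne', hQH ha⟩, k, hk, ha⟩

theorem subset_coneExt {G : Type*} [Group G] {H Q : Set G} (hQH : Q ⊆ H) :
    Q ⊆ coneExt H Q := fun a ha =>
  mem_coneExt_of_zpow_mem hQH one_pos (by simpa using ha)

theorem exists_pos_zpow_mem_of_mem_isolator {G : Type*} [Group G] {H : Subgroup G} {g : G}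
    (hg : g ∈ isolator (H : Set G)) : ∃ k : ℤ, 0 < k ∧ g ^ k ∈ H := by
  obtain ⟨k, hk, hkH⟩ := hg
  rcases lt_or_gt_of_ne hk with h | h
  · exact ⟨-k, by lia, by simpa using hkH⟩
  · exact ⟨k, h, hkH⟩

theorem IsLeftConeOn.coneExt {A : Type*} [CommGroup A]
    (hTF : ∀ a : A, a ≠ 1 → ¬ IsOfFinOrder a) {H : Subgroup A} {Q : Set A}
    (hQ : IsLeftConeOn (H : Set A) Q) :
    IsLeftConeOn (isolator (H : Set A)) (_root_.coneExt (H : Set A) Q) := by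
  obtain ⟨hQH, hmul, htri, hinv, hone⟩ := hQ
  refine ⟨fun a ha => ha.1, ?_, ?_, ?_, ?_⟩
  · rintro a ⟨-, k, hk, hak⟩ b ⟨-, l, hl, hbl⟩
    refine mem_coneExt_of_zpow_mem hQH (mul_pos hk hl) ?_
    rw [mul_zpow, zpow_mul, mul_comm k l, zpow_mul b]
    exact hmul _ (zpow_mem_of_mul_mem hmul hak hl) _ (zpow_mem_of_mul_mem hmul hbl hk)
  · intro g hg
    obtain ⟨k, hk, hkH⟩ := exists_pos_zpow_mem_of_mem_isolator hg
    rcases htri _ hkH with h | h | h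
    · exact Or.inl (mem_coneExt_of_zpow_mem hQH hk h)
    · exact Or.inr (Or.inl (mem_coneExt_of_zpow_mem hQH hk (by rwa [inv_zpow])))
    · refine Or.inr (Or.inr ?_)
      by_contra hg1
      exact hTF g hg1 (isOfFinOrder_iff_zpow_eq_one.2 ⟨k, hk.ne', h⟩)
  · rintro g ⟨-, k, hk, hgk⟩ ⟨-, l, hl, hgl⟩
    refine hinv _ (zpow_mem_of_mul_mem hmul hgk hl) ?_
    rw [← zpow_mul, mul_comm, zpow_mul, ← inv_zpow, ← inv_zpow]
    exact zpow_mem_of_mul_mem hmul hgl hk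
  · rintro ⟨-, k, -, h⟩
    exact hone (by simpa using h)

/-- A cone contained in another cone of the same set is equal to it. -/
theorem IsLeftConeOn.eq_of_subset {G : Type*} [Group G] {X P R : Set G}
    (hP : IsLeftConeOn X P) (hR : IsLeftConeOn X R) (h : P ⊆ R) : P = R := by
  refine h.antisymm fun a ha => ?_
  rcases hP.2.2.1 a (hR.1 ha) with h1 | h1 | h1
  · exact h1
  · exact absurd (h h1) (hR.2.2.2.1 a ha)
  · exact absurd (h1 ▸ ha) hR.2.2.2.2

/-- A cone of the isolator of `H` that contains `Q` contains every root of elements of `Q`. -/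
theorem IsLeftConeOn.coneExt_subset {G : Type*} [Group G] {H Q R : Set G}
    (hR : IsLeftConeOn (isolator H) R) (hQR : Q ⊆ R) : _root_.coneExt H Q ⊆ R := by
  obtain ⟨-, hmul, htri, hinv, hone⟩ := hR
  rintro a ⟨ha, k, hk, hak⟩
  rcases htri a ha with h | h | h
  · exact h
  · have := zpow_mem_of_mul_mem hmul h hk
    rw [inv_zpow] at this
    exact absurd this (hinv _ (hQR hak))
  · subst h
    exact absurd (hQR hak) (by simpa using hone)

/-- In a torsion-free abelian group `A`, every positive cone `Q` of a subgroup `H` extends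
uniquely to a positive cone of the isolator `I_A(H)`, namely to
`{a ∈ I_A(H) ∣ a ^ k ∈ Q for some k > 0}`. -/
theorem cone_extends_uniquely_to_isolator {A : Type*} [CommGroup A]
    (hTF : ∀ a : A, a ≠ 1 → ¬ IsOfFinOrder a)
    (H : Subgroup A) (Q : Set A) (hQ : IsLeftConeOn (H : Set A) Q) :
    IsLeftConeOn (isolator (H : Set A)) (coneExt (H : Set A) Q) ∧
    Q ⊆ coneExt (H : Set A) Q ∧
    (∀ R : Set A, IsLeftConeOn (isolator (H : Set A)) R → Q ⊆ R →
      R = coneExt (H : Set A) Q) := by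
  have hext := hQ.coneExt hTF
  exact ⟨hext, subset_coneExt hQ.1, fun R hR hQR =>
    (hext.eq_of_subset hR (hR.coneExt_subset hQR)).symm⟩
end
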